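/- Every minimally vertically 4-connected binary matroid with at least six elements has a 4-element cocircuit. -/

import Mathlib

open Set Matroid

universe u

variable {α : Type u}

/-- The rank of a set `X` in a matroid `M`: the supremum of the cardinalities of the
independent subsets of `X`. -/
noncomputable def mrk (M : Matroid α) (X : Set α) : ℕ∞ :=
  ⨆ I ∈ {I : Set α | M.Indep I ∧ I ⊆ X}, I.encard

/-- The rank `r(M)` of a matroid `M`. -/
noncomputable def mrank (M : Matroid α) : ℕ∞ := mrk M M.E

/-- The connectivity function `λ_M(X) = r(X) + r(E(M) - X) - r(M)`. -/
noncomputable def lam (M : Matroid α) (X : Set α) : ℕ∞ :=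
  mrk M X + mrk M (M.E \ X) - mrank M

/-- The deletion `M \ D` of a set of elements `D` from `M`. -/
def mdel (M : Matroid α) (D : Set α) : Matroid α := M ↾ (M.E \ D)

/-- A circuit of a matroid: a minimal dependent set. -/
def MCircuit (M : Matroid α) (C : Set α) : Prop := M.Dep C ∧ ∀ D, D ⊂ C → M.Indep D

/-- A cocircuit of a matroid: a circuit of the dual matroid. -/
def MCocircuit (M : Matroid α) (C : Set α) : Prop := MCircuit M✶ C

/-- A triangle: a 3-element circuit. -/
def IsTriangle (M : Matroid α) (T : Set α) : Prop := MCircuit M T ∧ T.encard = 3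

/-- `(X, Y)` is a vertical `j`-separation of `M`: a partition of `E(M)` with
`λ_M(X) < j` and `min {r(X), r(Y)} ≥ j`. -/
def IsVSep (M : Matroid α) (j : ℕ) (X Y : Set α) : Prop :=
  X ∪ Y = M.E ∧ Disjoint X Y ∧ lam M X < (j : ℕ∞) ∧
    (j : ℕ∞) ≤ mrk M X ∧ (j : ℕ∞) ≤ mrk M Y

/-- An exact vertical `j`-separation: one with `λ_M(X) = j - 1`. -/
def IsExactVSep (M : Matroid α) (j : ℕ) (X Y : Set α) : Prop :=
  IsVSep M j X Y ∧ lam M X = (j : ℕ∞) - 1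

/-- `M` is vertically `k`-connected: it has no vertical `j`-separation for a
positive integer `j < k`. -/
def VertConn (M : Matroid α) (k : ℕ) : Prop :=
  ∀ j X Y, 0 < j → j < k → ¬ IsVSep M j X Y

/-- `(X, Y)` is a (Tutte) `j`-separation of `M`. -/
def IsSep (M : Matroid α) (j : ℕ) (X Y : Set α) : Prop :=
  X ∪ Y = M.E ∧ Disjoint X Y ∧ lam M X < (j : ℕ∞) ∧
    (j : ℕ∞) ≤ X.encard ∧ (j : ℕ∞) ≤ Y.encard

/-- `M` is (Tutte) `k`-connected. -/
def TConn (M : Matroid α) (k : ℕ) : Prop :=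
  ∀ j X Y, 0 < j → j < k → ¬ IsSep M j X Y

/-- `M` is minimally vertically 4-connected. -/
def MinVertConn4 (M : Matroid α) : Prop :=
  VertConn M 4 ∧ ∀ e ∈ M.E, ¬ VertConn (mdel M {e}) 4

/-- `M` is a simple matroid: every subset of the ground set with at most two
elements is independent (no loops and no parallel pairs). -/
def MSimple (M : Matroid α) : Prop := ∀ S ⊆ M.E, S.encard ≤ 2 → M.Indep S

/-- `M` has a restriction isomorphic to `U_{2,4}`: a 4-element subset of the ground set
of rank 2, all of whose subsets with at most 2 elements are independent. -/
def HasU24Restriction (M : Matroid α) : Prop :=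
  ∃ X ⊆ M.E, X.encard = 4 ∧ mrk M X = 2 ∧ ∀ S ⊆ X, S.encard ≤ 2 → M.Indep S

/-- The restriction `M|X` is isomorphic to `U_{2,4}`. -/
def RestrIsoU24 (M : Matroid α) (X : Set α) : Prop :=
  X ⊆ M.E ∧ X.encard = 4 ∧ mrk M X = 2 ∧ ∀ S ⊆ X, S.encard ≤ 2 → M.Indep S

/-- The restriction `M|C` is isomorphic to `U_{2,k} ⊕ U_{2,2}`: `C` is the disjoint union
of a `k`-element rank-2 set `L` containing no loops or parallel pairs (a copy of `U_{2,k}`)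
and a 2-element independent set `P` (a copy of `U_{2,2}`), with `r(C) = r(L) + r(P) = 4`,
so that the restriction is the direct sum of the two pieces. -/
def RestrIsoLinePlusPair (M : Matroid α) (C : Set α) (k : ℕ) : Prop :=
  ∃ L P, C = L ∪ P ∧ Disjoint L P ∧ L.encard = (k : ℕ∞) ∧ P.encard = 2 ∧
    M.Indep P ∧ mrk M L = 2 ∧ (∀ S ⊆ L, S.encard ≤ 2 → M.Indep S) ∧ mrk M C = 4

/-- The restriction `M|X` is isomorphic to the 2-sum `U_{2,4} ⊕₂ U_{2,4}`: `X` is the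
disjoint union of two 3-element circuits `T₁` and `T₂`, and the circuits of `M` contained
in `X` (i.e. the circuits of `M|X`) are exactly `T₁`, `T₂`, and the unions `P₁ ∪ P₂` of
2-element subsets `P₁ ⊆ T₁` and `P₂ ⊆ T₂`. -/
def RestrIsoTwoSumU24U24 (M : Matroid α) (X : Set α) : Prop :=
  X ⊆ M.E ∧ ∃ T₁ T₂ : Set α, Disjoint T₁ T₂ ∧ X = T₁ ∪ T₂ ∧
    T₁.encard = 3 ∧ T₂.encard = 3 ∧
    ∀ C ⊆ X, (MCircuit M C ↔ (C = T₁ ∨ C = T₂ ∨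
      ∃ P₁ P₂, P₁ ⊆ T₁ ∧ P₂ ⊆ T₂ ∧ P₁.encard = 2 ∧ P₂.encard = 2 ∧ C = P₁ ∪ P₂))

/-- The columns of the `GF(3)`-matrix representing `N₉`. -/
def N9Cols : Fin 9 → Fin 4 → ZMod 3 :=
  ![![1, 0, 0, 0], ![0, 1, 0, 0], ![0, 0, 1, 0], ![0, 0, 0, 1], ![0, 1, 1, -1],
    ![1, 0, 1, 1], ![1, 1, 0, 1], ![-1, 1, 1, 0], ![1, -1, 1, -1]]

/-- `M` is isomorphic to `N₉`, the 9-element rank-4 matroid represented over `GF(3)`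
by the matrix with columns `N9Cols`. -/
def IsoN9 (M : Matroid α) : Prop :=
  ∃ φ : α → Fin 9, Set.BijOn φ M.E Set.univ ∧
    ∀ I ⊆ M.E, (M.Indep I ↔ LinearIndependent (ZMod 3) fun x : I => N9Cols (φ x.1))

/-- `M` is binary: representable over the two-element field `GF(2)`, i.e. there is a
map from the ground set to a `GF(2)`-vector space under which independence in `M`
coincides with linear independence. -/
def IsBinary (M : Matroid α) : Prop :=
  ∃ (ι : Type u) (φ : α → ι → ZMod 2),
    ∀ I ⊆ M.E, (M.Indep I ↔ LinearIndependent (ZMod 2) fun x : I => φ x.1)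

/-- `M` is a uniform matroid, i.e. isomorphic to `U_{m,n}` for some `m` and `n`:
the ground set has `n` elements and a subset of the ground set is independent
exactly when it has at most `m` elements. -/
def IsUniform (M : Matroid α) : Prop :=
  ∃ m n : ℕ, M.E.encard = (n : ℕ∞) ∧ ∀ I ⊆ M.E, (M.Indep I ↔ I.encard ≤ (m : ℕ∞))

section core
open Classical

variable {V : Type*} [AddCommGroup V] [Module (ZMod 2) V]

/-- span of the image of a finset -/
def spn (φ : α → V) (S : Finset α) : Submodule (ZMod 2) V :=
  Submodule.span (ZMod 2) (φ '' (S : Set α))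

/-- rank of a finset -/
noncomputable def rkf (φ : α → V) (S : Finset α) : ℕ := Module.finrank (ZMod 2) (spn φ S)

instance spn_fd (φ : α → V) (S : Finset α) : FiniteDimensional (ZMod 2) (spn φ S) :=
  FiniteDimensional.span_of_finite _ (S.finite_toSet.image _)

theorem spn_mono (φ : α → V) {S T : Finset α} (h : S ⊆ T) : spn φ S ≤ spn φ T :=
  Submodule.span_mono (Set.image_mono (by exact_mod_cast h))

theorem mem_spn (φ : α → V) {S : Finset α} {x : α} (h : x ∈ S) : φ x ∈ spn φ S :=
  Submodule.subset_span ⟨x, by exact_mod_cast h, rfl⟩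

theorem spn_le (φ : α → V) {S : Finset α} {U : Submodule (ZMod 2) V} (h : ∀ x ∈ S, φ x ∈ U) :
    spn φ S ≤ U := by
  unfold spn; rw [Submodule.span_le]; rintro _ ⟨x, hx, rfl⟩; exact h x (by exact_mod_cast hx)

theorem spn_union (φ : α → V) (S T : Finset α) : spn φ (S ∪ T) = spn φ S ⊔ spn φ T := by
  unfold spn; rw [Finset.coe_union, Set.image_union, Submodule.span_union]

theorem rkf_mono (φ : α → V) {S T : Finset α} (h : S ⊆ T) : rkf φ S ≤ rkf φ T :=
  Submodule.finrank_mono (spn_mono φ h)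

theorem rkf_submod (φ : α → V) (S T : Finset α) :
    rkf φ (S ∪ T) + rkf φ (S ∩ T) ≤ rkf φ S + rkf φ T := by
  unfold rkf
  rw [spn_union]
  have h := Submodule.finrank_sup_add_finrank_inf_eq (spn φ S) (spn φ T)
  have h2 : Module.finrank (ZMod 2) (spn φ (S ∩ T)) ≤
      Module.finrank (ZMod 2) ↥(spn φ S ⊓ spn φ T) := by
    apply Submodule.finrank_mono
    exact le_inf (spn_mono φ Finset.inter_subset_left) (spn_mono φ Finset.inter_subset_right)
  omega

theorem rkf_union_le (φ : α → V) (S T : Finset α) :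
    rkf φ (S ∪ T) ≤ rkf φ S + rkf φ T := by
  have := rkf_submod φ S T; omega

theorem rkf_le_card (φ : α → V) (S : Finset α) : rkf φ S ≤ S.card := by
  unfold rkf spn
  have h := finrank_span_finset_le_card (R := ZMod 2) (S.image φ)
  rw [Finset.coe_image] at h
  exact h.trans Finset.card_image_le

theorem rkf_insert_eq (φ : α → V) {S : Finset α} {x : α} (h : φ x ∈ spn φ S) :
    rkf φ (insert x S) = rkf φ S := by
  have : spn φ (insert x S) = spn φ S := by
    apply le_antisymm
    · apply spn_le; intro y hy
      rcases Finset.mem_insert.1 hy with rfl | hy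
      · exact h
      · exact mem_spn φ hy
    · exact spn_mono φ (Finset.subset_insert _ _)
  unfold rkf; rw [this]

theorem rkf_insert_le (φ : α → V) (S : Finset α) (x : α) :
    rkf φ (insert x S) ≤ rkf φ S + 1 := by
  have h := rkf_union_le φ S {x}
  have h2 := rkf_le_card φ {x}
  rw [Finset.card_singleton] at h2
  have : insert x S = S ∪ {x} := by grind
  rw [this]; omega

theorem rkf_insert_succ (φ : α → V) {S : Finset α} {x : α} (h : φ x ∉ spn φ S) :
    rkf φ (insert x S) = rkf φ S + 1 := by
  have h1 := rkf_insert_le φ S x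
  have h2 : rkf φ S < rkf φ (insert x S) := by
    apply Submodule.finrank_lt_finrank_of_lt
    refine lt_of_le_of_ne (spn_mono φ (Finset.subset_insert _ _)) ?_
    intro heq
    exact h (heq ▸ mem_spn φ (Finset.mem_insert_self _ _))
  omega

theorem spn_eq_of_rkf (φ : α → V) {S T : Finset α} (h : S ⊆ T) (hr : rkf φ T ≤ rkf φ S) :
    spn φ S = spn φ T :=
  Submodule.eq_of_le_of_finrank_le (spn_mono φ h) hr

theorem rkf_le_of (φ : α → V) {S T : Finset α} (h : ∀ x ∈ S, φ x ∈ spn φ T) : rkf φ S ≤ rkf φ T :=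
  Submodule.finrank_mono (spn_le φ h)

theorem exists_fun (φ : α → V) {S : Finset α} {x : α} (h : φ x ∉ spn φ S) :
    ∃ g : V →ₗ[ZMod 2] ZMod 2, (∀ y ∈ S, g (φ y) = 0) ∧ g (φ x) = 1 := by
  obtain ⟨g, hg, hle⟩ := Submodule.exists_le_ker_of_notMem h
  refine ⟨g, fun y hy => hle (mem_spn φ hy), ?_⟩
  generalize g (φ x) = c at hg
  revert c; decide

theorem exists_notin (φ : α → V) {S T : Finset α} (h : rkf φ S < rkf φ T) :
    ∃ x ∈ T, φ x ∉ spn φ S := by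
  by_contra! hc
  have := rkf_le_of φ hc
  omega

theorem fun_span (φ : α → V) {S : Finset α} {g : V →ₗ[ZMod 2] ZMod 2} (h : ∀ y ∈ S, g (φ y) = 0)
    {v : V} (hv : v ∈ spn φ S) : g v = 0 :=
  (spn_le φ (U := LinearMap.ker g) (fun x hx => h x hx)) hv

theorem card_spn (φ : α → V) (S : Finset α) : Nat.card (spn φ S) = 2 ^ rkf φ S := by
  have := Module.natCard_eq_pow_finrank (K := ZMod 2) (V := spn φ S)
  rw [this, Nat.card_zmod]; rfl

instance spn_finite (φ : α → V) (S : Finset α) : Finite (spn φ S) :=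
  Module.finite_of_finite (ZMod 2)

theorem card_img_le (φ : α → V) (S : Finset α) (A : Finset V) (h : ∀ a ∈ A, a ∈ spn φ S) :
    A.card ≤ 2 ^ rkf φ S := by
  rw [← card_spn]
  have : A.card = Nat.card (A : Set V) := by simp
  rw [this]
  exact Nat.card_mono (@Set.toFinite _ _ (spn_finite φ S)) h

theorem card_lt_pow (φ : α → V) {S : Finset α} (inj : ∀ x ∈ S, ∀ y ∈ S, φ x = φ y → x = y)
    (nz : ∀ x ∈ S, φ x ≠ 0) : S.card < 2 ^ rkf φ S := by
  have h := card_img_le φ S (insert 0 (S.image φ)) (by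
    intro a ha
    rcases Finset.mem_insert.1 ha with rfl | ha
    · exact zero_mem _
    · obtain ⟨x, hx, rfl⟩ := Finset.mem_image.1 ha; exact mem_spn φ hx)
  rw [Finset.card_insert_of_notMem, Finset.card_image_of_injOn] at h
  · omega
  · intro x hx y hy hxy; exact inj x hx y hy hxy
  · intro h0; obtain ⟨x, hx, hx0⟩ := Finset.mem_image.1 h0; exact nz x hx hx0

theorem zm_cases (a : ZMod 2) : a = 0 ∨ a = 1 := by revert a; decide

theorem card_affine (φ : α → V) {S : Finset α} (inj : ∀ x ∈ S, ∀ y ∈ S, φ x = φ y → x = y)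
    {g : V →ₗ[ZMod 2] ZMod 2} (hg : ∀ x ∈ S, g (φ x) = 1) : 2 * S.card ≤ 2 ^ rkf φ S := by
  rcases S.eq_empty_or_nonempty with rfl | ⟨s, hs⟩
  · simp
  have h := card_img_le φ S (S.image φ ∪ S.image (fun x => φ x + φ s)) (by
    intro a ha
    rcases Finset.mem_union.1 ha with ha | ha
    · obtain ⟨x, hx, rfl⟩ := Finset.mem_image.1 ha; exact mem_spn φ hx
    · obtain ⟨x, hx, rfl⟩ := Finset.mem_image.1 ha
      exact add_mem (mem_spn φ hx) (mem_spn φ hs))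
  rw [Finset.card_union_of_disjoint, Finset.card_image_of_injOn, Finset.card_image_of_injOn] at h
  · omega
  · intro x hx y hy hxy; exact inj x hx y hy (add_right_cancel hxy)
  · intro x hx y hy hxy; exact inj x hx y hy hxy
  · rw [Finset.disjoint_left]
    intro a ha hb
    obtain ⟨x, hx, rfl⟩ := Finset.mem_image.1 ha
    obtain ⟨y, hy, hxy⟩ := Finset.mem_image.1 hb
    have h1 := congrArg g hxy
    rw [map_add, hg x hx, hg y hy, hg s hs] at h1
    revert h1; decide

end core

section coreB
open Classical

variable {V : Type*} [AddCommGroup V] [Module (ZMod 2) V]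

structure FSep (φ : α → V) (E : Finset α) (e : α) (X Y : Finset α) : Prop where
  heX : e ∉ X
  heY : e ∉ Y
  dj : ∀ a ∈ X, a ∉ Y
  cov : ∀ a, a ∈ E ↔ a = e ∨ a ∈ X ∨ a ∈ Y
  rX : 3 ≤ rkf φ X
  rY : 3 ≤ rkf φ Y
  sum : rkf φ X + rkf φ Y ≤ rkf φ E + 2

structure FHyp (φ : α → V) (E : Finset α) : Prop where
  inj : ∀ x ∈ E, ∀ y ∈ E, φ x = φ y → x = y
  nz : ∀ x ∈ E, φ x ≠ 0
  conn : ∀ S T : Finset α, (∀ a, a ∈ E ↔ a ∈ S ∨ a ∈ T) → (∀ a ∈ S, a ∉ T) →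
    3 ≤ rkf φ S → 3 ≤ rkf φ T → rkf φ E + 3 ≤ rkf φ S + rkf φ T
  sep : ∀ e ∈ E, ∃ X Y, FSep φ E e X Y
  coc : ∀ S T : Finset α, (∀ a ∈ E, a ∈ S ∨ a ∈ T) → rkf φ S < rkf φ E → 5 ≤ T.card

variable {φ : α → V} {E : Finset α}

theorem FSep.symm {e : α} {X Y : Finset α} (h : FSep φ E e X Y) : FSep φ E e Y X :=
  ⟨h.heY, h.heX, fun a ha hb => h.dj a hb ha, fun a => by rw [h.cov]; tauto, h.rY, h.rX,
    by have := h.sum; omega⟩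

theorem FHyp.card_lt (H : FHyp φ E) {S : Finset α} (hS : S ⊆ E) : S.card < 2 ^ rkf φ S :=
  card_lt_pow φ (fun x hx y hy => H.inj x (hS hx) y (hS hy)) (fun x hx => H.nz x (hS hx))

theorem FHyp.card_le3 (H : FHyp φ E) {S : Finset α} (hS : S ⊆ E) (h : rkf φ S ≤ 2) :
    S.card ≤ 3 := by
  have h1 := H.card_lt hS
  have h2 := Nat.pow_le_pow_right (n := 2) (by norm_num) h
  omega

theorem FHyp.card_le1 (H : FHyp φ E) {S : Finset α} (hS : S ⊆ E) (h : rkf φ S ≤ 1) :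
    S.card ≤ 1 := by
  have h1 := H.card_lt hS
  have h2 := Nat.pow_le_pow_right (n := 2) (by norm_num) h
  omega

theorem FHyp.affine2 (H : FHyp φ E) {S : Finset α} (hS : S ⊆ E) (h : rkf φ S ≤ 2)
    {g : V →ₗ[ZMod 2] ZMod 2} (hg : ∀ x ∈ S, g (φ x) = 1) : S.card ≤ 2 := by
  have h1 := card_affine φ (fun x hx y hy => H.inj x (hS hx) y (hS hy)) hg
  have h2 := Nat.pow_le_pow_right (n := 2) (by norm_num) h
  omega

theorem FHyp.notin (H : FHyp φ E) {e : α} {X Y : Finset α} (h : FSep φ E e X Y) :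
    φ e ∉ spn φ X := by
  intro hc
  have h1 := rkf_insert_eq φ hc
  have h2 := H.conn (insert e X) Y (by intro a; rw [h.cov]; grind) (by
    have := h.dj; have := h.heY; grind) (by have := h.rX; omega) h.rY
  have := h.sum
  omega

theorem FHyp.sum_eq (H : FHyp φ E) {e : α} {X Y : Finset α} (h : FSep φ E e X Y) :
    rkf φ X + rkf φ Y = rkf φ E + 2 := by
  have h1 := rkf_insert_succ φ (H.notin h)
  have h2 := H.conn (insert e X) Y (by intro a; rw [h.cov]; grind) (by
    have := h.dj; have := h.heY; grind) (by have := h.rX; omega) h.rY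
  have := h.sum
  omega

theorem FHyp.uncross_a (H : FHyp φ E) {e f : α} {X Y Z W : Finset α} (h : FSep φ E e X Y)
    (k : FSep φ E f Z W) (hf : f ∈ X) (he : e ∈ Z) (hA : 3 ≤ rkf φ (X ∩ W))
    (hD : 2 ≤ rkf φ (Y ∩ Z)) : FSep φ E f (X ∩ W) (Y ∪ Z) := by
  obtain ⟨heX, heY, dj, cov, rX, rY, sum⟩ := h
  have hh : FSep φ E e X Y := ⟨heX, heY, dj, cov, rX, rY, sum⟩
  obtain ⟨hfZ, hfW, dj', cov', rZ, rW, sum'⟩ := k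
  have h1 : φ e ∉ spn φ (Y ∩ Z) := fun hc =>
    H.notin hh.symm (spn_mono φ Finset.inter_subset_left hc)
  have h2 := rkf_insert_succ φ h1
  have h3 := H.conn (insert e (Y ∩ Z)) (X ∪ W) (by intro a; grind) (by grind) (by omega)
    (rX.trans (rkf_mono φ Finset.subset_union_left))
  have s1 := rkf_submod φ X W
  have s2 := rkf_submod φ Y Z
  refine ⟨by grind, by grind, by grind, by intro a; grind, hA,
    rY.trans (rkf_mono φ Finset.subset_union_left), by omega⟩

theorem FHyp.uncross_b (H : FHyp φ E) {e f : α} {X Y Z W : Finset α} (h : FSep φ E e X Y)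
    (k : FSep φ E f Z W) (hf : f ∈ X) (he : e ∈ Z) (hC : 3 ≤ rkf φ (Y ∩ W))
    (hB : 2 ≤ rkf φ (X ∩ Z)) : FSep φ E e (insert f (X ∩ Z)) (Y ∪ W) := by
  have kk := k
  obtain ⟨heX, heY, dj, cov, rX, rY, sum⟩ := h
  obtain ⟨hfZ, hfW, dj', cov', rZ, rW, sum'⟩ := k
  have h1 : φ f ∉ spn φ (X ∩ Z) := fun hc =>
    H.notin kk (spn_mono φ Finset.inter_subset_right hc)
  have h2 := rkf_insert_succ φ h1
  have h3 := H.conn (Y ∩ W) (X ∪ Z) (by intro a; grind) (by grind) hC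
    (rX.trans (rkf_mono φ Finset.subset_union_left))
  have s1 := rkf_submod φ X Z
  have s2 := rkf_submod φ Y W
  refine ⟨by grind, by grind, by grind, by intro a; grind, by omega,
    rY.trans (rkf_mono φ Finset.subset_union_left), by omega⟩

theorem FHyp.trim (H : FHyp φ E) {e x : α} {X Y : Finset α} (h : FSep φ E e X Y)
    (hx : x ∈ X) (hs : φ x ∈ spn φ Y) : FSep φ E e (X.erase x) (insert x Y) := by
  have hn := H.notin h
  have hsum := H.sum_eq h
  obtain ⟨heX, heY, dj, cov, rX, rY, sum⟩ := h
  have h1 := rkf_insert_eq φ hs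
  have h2 : rkf φ (X.erase x) ≤ rkf φ X := rkf_mono φ (Finset.erase_subset _ _)
  have h3 : rkf φ X ≤ rkf φ (X.erase x) + 1 := by
    have := rkf_insert_le φ (X.erase x) x
    rwa [Finset.insert_erase hx] at this
  have h4 : φ e ∉ spn φ (X.erase x) := fun hc => hn (spn_mono φ (Finset.erase_subset _ _) hc)
  have h5 := rkf_insert_succ φ h4
  have h6 := H.conn (insert e (X.erase x)) (insert x Y) (by intro a; grind) (by grind) (by omega)
    (by omega)
  refine ⟨by grind, by grind, by grind, by intro a; grind, by omega, by omega, by omega⟩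

theorem FHyp.fcoc (H : FHyp φ E) {g : V →ₗ[ZMod 2] ZMod 2} {x : α} (hx : x ∈ E)
    (hg : g (φ x) = 1) (T : Finset α) (hT : ∀ a ∈ E, g (φ a) = 1 → a ∈ T) : 5 ≤ T.card := by
  apply H.coc (E.filter (fun a => g (φ a) = 0)) T
  · intro a ha
    rcases zm_cases (g (φ a)) with h | h
    · left; simp [ha, h]
    · right; exact hT a ha h
  · by_contra hc
    have := spn_eq_of_rkf φ (Finset.filter_subset (fun a => g (φ a) = 0) E) (by omega)
    have h2 : φ x ∈ spn φ (E.filter (fun a => g (φ a) = 0)) := this ▸ mem_spn φ hx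
    have h3 := fun_span φ (g := g) (by intro y hy; exact (Finset.mem_filter.1 hy).2) h2
    rw [hg] at h3
    revert h3; decide

theorem FHyp.coc2 (H : FHyp φ E) (S T : Finset α) (hS : S ⊆ E) (hT : ∀ a ∈ E, a ∈ S ∨ a ∈ T)
    (hr : rkf φ S + 2 ≤ rkf φ E) : 8 ≤ T.card := by
  obtain ⟨t, htE, ht⟩ := exists_notin φ (S := S) (T := E) (by omega)
  have h1 := rkf_insert_succ φ ht
  obtain ⟨s, hsE, hs⟩ := exists_notin φ (S := insert t S) (T := E) (by omega)
  obtain ⟨g, hg, hgt⟩ := exists_fun φ ht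
  obtain ⟨k, hk, hks⟩ := exists_fun φ hs
  have hkt := hk t (Finset.mem_insert_self _ _)
  have a1 := H.fcoc htE hgt (T.filter (fun a => g (φ a) = 1)) (by
    intro a ha h
    have := hT a ha
    rcases this with h2 | h2
    · rw [hg a h2] at h; exfalso; revert h; decide
    · simp [h2, h])
  have a2 := H.fcoc hsE hks (T.filter (fun a => k (φ a) = 1)) (by
    intro a ha h
    have := hT a ha
    rcases this with h2 | h2
    · rw [hk a (by simp [h2])] at h; exfalso; revert h; decide
    · simp [h2, h])
  have a3 := H.fcoc (g := g + k) htE (by simp [hgt, hkt]) (T.filter (fun a => (g + k) (φ a) = 1)) (by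
    intro a ha h
    have := hT a ha
    rcases this with h2 | h2
    · rw [LinearMap.add_apply, hk a (by simp [h2]), hg a h2] at h; exfalso; revert h; decide
    · simp only [Finset.mem_filter]; exact ⟨h2, h⟩)
  rw [Finset.card_filter] at a1 a2 a3
  have : (∑ i ∈ T, if g (φ i) = 1 then 1 else 0) + (∑ i ∈ T, if k (φ i) = 1 then 1 else 0)
      + (∑ i ∈ T, if (g + k) (φ i) = 1 then 1 else 0) ≤ ∑ i ∈ T, 2 := by
    rw [← Finset.sum_add_distrib, ← Finset.sum_add_distrib]
    apply Finset.sum_le_sum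
    intro i _
    rw [LinearMap.add_apply]
    generalize g (φ i) = c
    generalize k (φ i) = d
    revert c d; decide
  rw [Finset.sum_const, smul_eq_mul] at this
  omega

theorem FHyp.sub (_H : FHyp φ E) {e : α} {X Y : Finset α} (h : FSep φ E e X Y) : X ⊆ E := by
  intro a ha; rw [h.cov]; tauto

theorem FHyp.card4 (H : FHyp φ E) {e : α} {X Y : Finset α} (h : FSep φ E e X Y) : 4 ≤ X.card := by
  have h1 := H.coc Y (insert e X) (by intro a ha; have := (h.cov a).1 ha; grind) (by
    have := h.rX; have := h.sum; omega)
  have := Finset.card_insert_le e X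
  omega

theorem FHyp.card7 (H : FHyp φ E) {e : α} {X Y : Finset α} (h : FSep φ E e X Y)
    (hr : 4 ≤ rkf φ X) : 7 ≤ X.card := by
  have h1 := H.coc2 Y (insert e X) (H.sub h.symm)
    (by intro a ha; have := (h.cov a).1 ha; grind) (by have := h.sum; omega)
  have := Finset.card_insert_le e X
  omega

/-- If `rk X = 3`, there is a functional vanishing exactly on the elements of `E` in span of `Y`. -/
theorem FHyp.funct (H : FHyp φ E) {e : α} {X Y : Finset α} (h : FSep φ E e X Y)
    (hr : rkf φ X = 3) : ∃ g : V →ₗ[ZMod 2] ZMod 2, (∀ y ∈ Y, g (φ y) = 0) ∧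
      ∀ x ∈ E, φ x ∉ spn φ Y → g (φ x) = 1 := by
  have hs := H.sum_eq h
  obtain ⟨t, htE, ht⟩ := exists_notin φ (S := Y) (T := E) (by omega)
  obtain ⟨g, hg, hgt⟩ := exists_fun φ ht
  refine ⟨g, hg, fun x hx hxn => ?_⟩
  rcases zm_cases (g (φ x)) with h0 | h0
  · exfalso
    have h1 := rkf_insert_succ φ hxn
    have h2 := spn_eq_of_rkf φ (S := insert x Y) (T := E) (by
      have := H.sub h.symm; grind) (by omega)
    have h3 : φ t ∈ spn φ (insert x Y) := h2 ▸ mem_spn φ htE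
    have h4 := fun_span φ (g := g) (by
      intro y hy
      rcases Finset.mem_insert.1 hy with rfl | hy
      · exact h0
      · exact hg y hy) h3
    rw [hgt] at h4
    revert h4; decide
  · exact h0

end coreB

section coreC
open Classical

variable {V : Type*} [AddCommGroup V] [Module (ZMod 2) V]
variable {φ : α → V} {E : Finset α}

theorem rkf_eq_card (φ : α → V) (S : Finset α) (h : ∀ x ∈ S, φ x ∉ spn φ (S.erase x)) :
    S.card ≤ rkf φ S := by
  induction S using Finset.induction_on with
  | empty => simp
  | insert a S ha ih =>
    have h1 : φ a ∉ spn φ S := by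
      have := h a (Finset.mem_insert_self _ _)
      rwa [Finset.erase_insert ha] at this
    rw [rkf_insert_succ φ h1, Finset.card_insert_of_notMem ha]
    have := ih (by
      intro x hx hc
      refine h x (Finset.mem_insert_of_mem hx) (spn_mono φ ?_ hc)
      grind)
    omega

def FMin (φ : α → V) (E : Finset α) (X : Finset α) : Prop :=
  ∀ e' X' Y', FSep φ E e' X' Y' → X.card ≤ X'.card

theorem FHyp.min_notin (H : FHyp φ E) {e : α} {X Y : Finset α} (h : FSep φ E e X Y)
    (hm : FMin φ E X) : ∀ x ∈ X, φ x ∉ spn φ Y := by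
  intro x hx hc
  have := hm _ _ _ (H.trim h hx hc)
  have := Finset.card_erase_lt_of_mem hx
  omega

theorem FHyp.min_dep (H : FHyp φ E) {e : α} {X Y : Finset α} (h : FSep φ E e X Y) :
    ∃ f ∈ X, φ f ∈ spn φ (X.erase f) := by
  by_contra! hc
  have h1 := rkf_eq_card φ X hc
  have h0 := rkf_le_card φ X
  have h4 := H.card4 h
  obtain ⟨X0, hX0, hcard⟩ := Finset.exists_subset_card_eq (s := X) (n := X.card - 3) (by omega)
  have h2 := rkf_union_le φ Y X0
  have h3 := rkf_le_card φ X0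
  have h5 := H.coc (Y ∪ X0) (insert e (X \ X0)) (by
    intro a ha; have := (h.cov a).1 ha; grind) (by have := h.sum; omega)
  have h6 := Finset.card_insert_le e (X \ X0)
  have h7 := Finset.card_sdiff_of_subset hX0
  omega

theorem FHyp.partA (H : FHyp φ E) {e f : α} {X Y Z W : Finset α} (h : FSep φ E e X Y)
    (hm : FMin φ E X) (hf : f ∈ X) (hfs : φ f ∈ spn φ (X.erase f)) (k : FSep φ E f Z W)
    (he : e ∈ Z) : rkf φ X = 3 ∧ X.card = 4 ∧ (X ∩ Z).card = 1 ∧ (X ∩ W).card = 2 := by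
  have hXE := H.sub h
  have hYE := H.sub h.symm
  have hAE : X ∩ W ⊆ E := fun a ha => hXE (Finset.mem_inter.1 ha).1
  have hBE : X ∩ Z ⊆ E := fun a ha => hXE (Finset.mem_inter.1 ha).1
  have hCE : Y ∩ W ⊆ E := fun a ha => hYE (Finset.mem_inter.1 ha).1
  have hDE : Y ∩ Z ⊆ E := fun a ha => hYE (Finset.mem_inter.1 ha).1
  have hX : X = insert f ((X ∩ Z) ∪ (X ∩ W)) := by
    ext a; have := h.cov a; have := k.cov a; grind
  have hZ : Z = insert e ((X ∩ Z) ∪ (Y ∩ Z)) := by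
    ext a; have := h.cov a; have := k.cov a; grind
  have hW : W = (X ∩ W) ∪ (Y ∩ W) := by
    ext a; have := h.cov a; have := k.cov a; have := k.dj e he; grind
  have cX : X.card = (X ∩ Z).card + (X ∩ W).card + 1 := by
    conv_lhs => rw [hX]
    rw [Finset.card_insert_of_notMem, Finset.card_union_of_disjoint]
    · rw [Finset.disjoint_left]; have := k.dj; grind
    · have := k.heX; have := k.heY; grind
  have cZ : Z.card = (X ∩ Z).card + (Y ∩ Z).card + 1 := by
    conv_lhs => rw [hZ]
    rw [Finset.card_insert_of_notMem, Finset.card_union_of_disjoint]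
    · rw [Finset.disjoint_left]; have := h.dj; grind
    · have := h.heX; have := h.heY; grind
  have cW : W.card = (X ∩ W).card + (Y ∩ W).card := by
    conv_lhs => rw [hW]
    rw [Finset.card_union_of_disjoint]
    rw [Finset.disjoint_left]; have := h.dj; grind
  have mZ := hm _ _ _ k
  have mW := hm _ _ _ k.symm
  have neA : 1 ≤ (X ∩ W).card := by
    by_contra hc
    have h0 : X ∩ W = ∅ := by rw [← Finset.card_eq_zero]; omega
    apply H.notin k
    refine spn_mono φ ?_ hfs
    intro a ha; rw [h0] at hX; grind
  have neB : 1 ≤ (X ∩ Z).card := by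
    by_contra hc
    have h0 : X ∩ Z = ∅ := by rw [← Finset.card_eq_zero]; omega
    apply H.notin k.symm
    refine spn_mono φ ?_ hfs
    intro a ha; rw [h0] at hX; grind
  have rA : rkf φ (X ∩ W) ≤ 2 := by
    by_contra hc
    have hD : rkf φ (Y ∩ Z) ≤ 1 := by
      by_contra hd
      have := hm _ _ _ (H.uncross_a h k hf he (by omega) (by omega))
      omega
    have h1 := H.card_le1 hDE hD
    have h2 := rkf_le_card φ (X ∩ W)
    omega
  have cA := H.card_le3 hAE rA
  by_cases rB : rkf φ (X ∩ Z) ≤ 1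
  · have cB := H.card_le1 hBE rB
    have rX : rkf φ X = 3 := by
      have h1 : rkf φ X ≤ rkf φ ((X ∩ Z) ∪ (X ∩ W)) := by
        have h2 := rkf_insert_eq φ hfs
        rw [Finset.insert_erase hf] at h2
        rw [h2]
        apply rkf_mono
        intro a ha; grind
      have h2 := rkf_union_le φ (X ∩ Z) (X ∩ W)
      have := h.rX
      omega
    obtain ⟨g, hg, hg1⟩ := H.funct h rX
    have hx1 : ∀ x ∈ X, g (φ x) = 1 := fun x hx => hg1 x (hXE hx) (H.min_notin h hm x hx)
    have h1 := H.affine2 hAE rA (g := g) (fun x hx => hx1 x (Finset.mem_inter.1 hx).1)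
    have h4 := H.card4 h
    refine ⟨rX, by omega, by omega, by omega⟩
  · exfalso
    have rC : rkf φ (Y ∩ W) ≤ 2 := by
      by_contra hc
      have h1 := hm _ _ _ (H.uncross_b h k hf he (by omega) (by omega))
      have := Finset.card_insert_le f (X ∩ Z)
      omega
    have cC := H.card_le3 hCE rC
    have cB : 2 ≤ (X ∩ Z).card := by have := rkf_le_card φ (X ∩ Z); omega
    have hmW : FMin φ E W := by
      intro e' X' Y' h'
      have := hm _ _ _ h'
      omega
    by_cases rW : 4 ≤ rkf φ W
    · have := H.card7 k.symm rW
      omega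
    · obtain ⟨g, hg, hg1⟩ := H.funct k.symm (by have := k.rY; omega)
      have := H.affine2 hCE rC (g := g) (fun x hx => hg1 x (hCE hx)
        (H.min_notin k.symm hmW x (Finset.mem_inter.1 hx).2))
      omega

theorem pair_mem (φ : α → V) {C : Finset α} {a b : α} {g : V →ₗ[ZMod 2] ZMod 2}
    (hg : ∀ y ∈ C, g (φ y) = 0) (ha : g (φ a) = 1) (hb : g (φ b) = 1)
    (hr : rkf φ (insert a (insert b C)) ≤ rkf φ C + 1) : φ a + φ b ∈ spn φ C := by
  have hb' : φ b ∉ spn φ C := by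
    intro hc; have := fun_span φ hg hc; rw [hb] at this; revert this; decide
  have h1 := rkf_insert_succ φ hb'
  have h2 : φ a ∈ spn φ (insert b C) := by
    by_contra hc
    have := rkf_insert_succ φ hc
    omega
  unfold spn at h2
  rw [Finset.coe_insert, Set.image_insert_eq, Submodule.mem_span_insert] at h2
  obtain ⟨c, z, hz, hc⟩ := h2
  have hgz := fun_span φ hg (v := z) hz
  have h3 := congrArg g hc
  rw [map_add, map_smul, ha, hb, hgz] at h3
  have h4 : c = 1 := by simpa using h3.symm
  have h5 : φ a + φ b = z := by
    rw [hc, h4, one_smul]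
    have : φ b + φ b = 0 := ZModModule.add_self _
    rw [add_right_comm, this, zero_add]
  rw [h5]; exact hz

/-- the situation after Part A -/
structure FCtx (φ : α → V) (E : Finset α) (e : α) (X Y : Finset α) (g : V →ₗ[ZMod 2] ZMod 2) :
    Prop where
  h : FSep φ E e X Y
  card : X.card = 4
  gX : ∀ x ∈ X, g (φ x) = 1
  ge : g (φ e) = 1
  gY : ∀ y ∈ Y, g (φ y) = 0
  sum : ∑ x ∈ X, φ x = 0
  nosep : ∀ f ∈ X, ∀ Z W, FSep φ E f Z W → e ∈ Z → (X ∩ Z).card = 1 ∧ (X ∩ W).card = 2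

theorem FHyp.exists_ctx (H : FHyp φ E) (hne : E.Nonempty) : ∃ e X Y g, FCtx φ E e X Y g := by
  have hex : ∃ n, ∃ e X Y, FSep φ E e X Y ∧ X.card = n := by
    obtain ⟨e, he⟩ := hne
    obtain ⟨X, Y, h⟩ := H.sep e he
    exact ⟨_, e, X, Y, h, rfl⟩
  obtain ⟨e, X, Y, h, hc⟩ := Nat.find_spec hex
  have hm : FMin φ E X := by
    intro e' X' Y' h'
    rw [hc]
    exact Nat.find_min' hex ⟨e', X', Y', h', rfl⟩
  have hXE := H.sub h
  have key : ∀ f ∈ X, φ f ∈ spn φ (X.erase f) → ∀ Z W, FSep φ E f Z W → e ∈ Z →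
      rkf φ X = 3 ∧ X.card = 4 ∧ (X ∩ Z).card = 1 ∧ (X ∩ W).card = 2 :=
    fun f hf hfs Z W k he => H.partA h hm hf hfs k he
  obtain ⟨f, hf, hfs⟩ := H.min_dep h
  have h34 : rkf φ X = 3 ∧ X.card = 4 := by
    obtain ⟨Z, W, k⟩ := H.sep f (hXE hf)
    have heE : e ∈ E := by rw [h.cov]; tauto
    rcases (k.cov e).1 heE with h1 | h1 | h1
    · exact absurd (h1 ▸ hf) h.heX
    · obtain ⟨h1, h2, -⟩ := key f hf hfs Z W k h1; exact ⟨h1, h2⟩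
    · obtain ⟨h1, h2, -⟩ := key f hf hfs W Z k.symm h1; exact ⟨h1, h2⟩
  obtain ⟨r3, c4⟩ := h34
  obtain ⟨g, hg, hg1⟩ := H.funct h r3
  have gX : ∀ x ∈ X, g (φ x) = 1 := fun x hx => hg1 x (hXE hx) (H.min_notin h hm x hx)
  have sum : ∑ x ∈ X, φ x = 0 := by
    have c3 : (X.erase f).card = 3 := by rw [Finset.card_erase_of_mem hf]; omega
    rw [← Finset.add_sum_erase X φ hf]
    have hfn : f ∉ X.erase f := by simp
    have hsub : ∀ x ∈ X.erase f, x ∈ X := fun x hx => Finset.mem_of_mem_erase hx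
    obtain ⟨a, b, c, hab, hac, hbc, habc⟩ := Finset.card_eq_three.1 c3
    rw [habc] at hfn hsub hfs ⊢
    have ha := hsub a (by simp)
    have hb := hsub b (by simp)
    have hc := hsub c (by simp)
    rw [Finset.sum_insert (by simp [hab, hac]), Finset.sum_insert (by simp [hbc]),
      Finset.sum_singleton]
    unfold spn at hfs
    simp only [Finset.coe_insert, Finset.coe_singleton, Set.image_insert_eq,
      Set.image_singleton] at hfs
    rw [Submodule.mem_span_triple] at hfs
    obtain ⟨p, q, s, hpq⟩ := hfs
    have h1 := congrArg g hpq
    rw [map_add, map_add, map_smul, map_smul, map_smul, gX a ha, gX b hb, gX c hc, gX f hf] at h1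
    have hj : ∀ x ∈ X, φ x = φ f → x = f := fun x hx hxf => H.inj x (hXE hx) f (hXE hf) hxf
    have hself : φ f + φ f = 0 := ZModModule.add_self _
    have a1 := hj a ha
    have a2 := hj b hb
    have a3 := hj c hc
    simp only [Finset.mem_insert, Finset.mem_singleton, not_or] at hfn
    rcases zm_cases p with rfl | rfl <;> rcases zm_cases q with rfl | rfl <;>
      rcases zm_cases s with rfl | rfl
    · exfalso; revert h1; decide
    · exfalso; simp at hpq; exact hfn.2.2 (a3 hpq).symm
    · exfalso; simp at hpq; exact hfn.2.1 (a2 hpq).symm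
    · exfalso; revert h1; decide
    · exfalso; simp at hpq; exact hfn.1 (a1 hpq).symm
    · exfalso; revert h1; decide
    · exfalso; revert h1; decide
    · simp only [one_smul] at hpq
      rw [← add_assoc (φ a), hpq, hself]
  refine ⟨e, X, Y, g, h, c4, gX, ?_, hg, sum, ?_⟩
  · exact hg1 e (by rw [h.cov]; tauto) (H.notin h.symm)
  · intro f' hf' Z W k he
    refine (key f' hf' ?_ Z W k he).2.2
    rw [← Finset.add_sum_erase X φ hf'] at sum
    rw [eq_neg_of_add_eq_zero_left sum]
    exact neg_mem (sum_mem fun x hx => mem_spn φ hx)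

end coreC

section coreD
open Classical

variable {V : Type*} [AddCommGroup V] [Module (ZMod 2) V]
variable {φ : α → V} {E : Finset α}

theorem add_self2 (v : V) : v + v = 0 := ZModModule.add_self v

theorem quad_mem {p q s t : V} (h : p + q + s + t = 0) {U : Submodule (ZMod 2) V}
    (hq : q ∈ U) (hs : s ∈ U) (ht : t ∈ U) : p ∈ U := by
  have : p = -(q + s + t) := by
    rw [eq_neg_iff_add_eq_zero, ← h]; abel
  rw [this]
  exact neg_mem (add_mem (add_mem hq hs) ht)

theorem quad_pair {p q s t : V} (h : p + q + s + t = 0) {U : Submodule (ZMod 2) V}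
    (hst : s + t ∈ U) : p + q ∈ U := by
  have : p + q = -(s + t) := by
    rw [eq_neg_iff_add_eq_zero, ← h]; abel
  rw [this]; exact neg_mem hst

set_option maxHeartbeats 2000000 in
theorem FHyp.perF (H : FHyp φ E) {e f : α} {X Y : Finset α} {g : V →ₗ[ZMod 2] ZMod 2}
    (c : FCtx φ E e X Y g) (hf : f ∈ X) : ∃ b ∈ X, ∃ C D : Finset α, b ≠ f ∧
      (∀ a, a ∈ Y ↔ a ∈ C ∨ a ∈ D) ∧ (∀ a ∈ C, a ∉ D) ∧ φ e + φ b ∈ spn φ D ∧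
      φ f + φ b ∈ spn φ C ∧ rkf φ C + rkf φ D ≤ rkf φ E ∧ 5 ≤ C.card ∧ 5 ≤ D.card := by
  obtain ⟨h, card, gX, ge, gY, sum, nosep⟩ := c
  have hXE := H.sub h
  have hYE := H.sub h.symm
  have heE : e ∈ E := by rw [h.cov]; tauto
  have hZW : ∃ Z W, FSep φ E f Z W ∧ e ∈ Z := by
    obtain ⟨Z, W, k⟩ := H.sep f (hXE hf)
    rcases (k.cov e).1 heE with h1 | h1 | h1
    · exact absurd (h1 ▸ hf) h.heX
    · exact ⟨Z, W, k, h1⟩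
    · exact ⟨W, Z, k.symm, h1⟩
  obtain ⟨Z, W, k, he⟩ := hZW
  obtain ⟨cB, cA⟩ := nosep f hf Z W k he
  obtain ⟨b, hB⟩ := Finset.card_eq_one.1 cB
  obtain ⟨a, a', haa, hA⟩ := Finset.card_eq_two.1 cA
  have hbX : b ∈ X ∧ b ∈ Z := by
    have : b ∈ X ∩ Z := by rw [hB]; simp
    exact Finset.mem_inter.1 this
  have haX : a ∈ X ∧ a ∈ W := by
    have : a ∈ X ∩ W := by rw [hA]; simp
    exact Finset.mem_inter.1 this
  have haX' : a' ∈ X ∧ a' ∈ W := by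
    have : a' ∈ X ∩ W := by rw [hA]; simp
    exact Finset.mem_inter.1 this
  have hX : X = {f, b, a, a'} := by
    have : X = insert f ((X ∩ Z) ∪ (X ∩ W)) := by
      ext x; have := h.cov x; have := k.cov x; grind
    rw [hB, hA] at this
    rw [this]; ext x; grind
  have hfZ := k.heX
  have hfW := k.heY
  have hbf : b ≠ f := fun hh => hfZ (hh ▸ hbX.2)
  have hbW : b ∉ W := k.dj b hbX.2
  have hq : φ f + φ b + φ a + φ a' = 0 := by
    rw [hX, Finset.sum_insert, Finset.sum_insert, Finset.sum_insert, Finset.sum_singleton] at sum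
    · rw [← sum]; abel
    · simp [haa]
    · simp only [Finset.mem_insert, Finset.mem_singleton, not_or]
      exact ⟨fun hh => hbW (hh ▸ haX.2), fun hh => hbW (hh ▸ haX'.2)⟩
    · simp only [Finset.mem_insert, Finset.mem_singleton, not_or]
      exact ⟨fun hh => hbf hh.symm, fun hh => hfW (hh ▸ haX.2), fun hh => hfW (hh ▸ haX'.2)⟩
  have hWeq : W = insert a (insert a' (Y ∩ W)) := by
    ext x; have := h.cov x; have := k.cov x; have := k.dj e he
    have : x ∈ X ∩ W ↔ x ∈ ({a, a'} : Finset α) := by rw [hA]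
    grind
  have hZeq : Z = insert e (insert b (Y ∩ Z)) := by
    ext x; have := h.cov x; have := k.cov x
    have : x ∈ X ∩ Z ↔ x ∈ ({b} : Finset α) := by rw [hB]
    grind
  have ksum := H.sum_eq k
  have gC : ∀ y ∈ Y ∩ W, g (φ y) = 0 := fun y hy => gY y (Finset.mem_inter.1 hy).1
  have gD : ∀ y ∈ Y ∩ Z, g (φ y) = 0 := fun y hy => gY y (Finset.mem_inter.1 hy).1
  -- moving elements across is impossible
  have naZ : ∀ x ∈ X ∩ W, φ x ∉ spn φ Z := by
    intro x hx hc
    have h1 := nosep f hf _ _ (H.trim k.symm (Finset.mem_inter.1 hx).2 hc).symm (by simp [he])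
    have h2 : X ∩ W.erase x = (X ∩ W).erase x := by ext y; grind
    rw [h2, Finset.card_erase_of_mem hx] at h1
    omega
  have neW : φ e ∉ spn φ W := by
    intro hc
    have h1 := nosep f hf _ _ (H.trim k he hc).symm (by simp)
    have h2 : X ∩ insert e W = X ∩ W := by ext y; have := h.heX; grind
    rw [h2] at h1
    omega
  have rW : 4 ≤ rkf φ W := by
    by_contra hc
    obtain ⟨p, hp, hp1⟩ := H.funct k.symm (by have := k.rY; omega)
    have h1 := hp1 f (hXE hf) (H.notin k)
    have h2 := hp1 a (hXE haX.1) (naZ a (Finset.mem_inter.2 haX))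
    have h3 := hp1 a' (hXE haX'.1) (naZ a' (Finset.mem_inter.2 haX'))
    have h4 := hp b hbX.2
    have h5 := congrArg p hq
    rw [map_add, map_add, map_add, h1, h2, h3, h4, map_zero] at h5
    revert h5; decide
  have hbD : φ b ∉ spn φ (Y ∩ Z) := by
    intro hc; have := fun_span φ gD hc; rw [gX b hbX.1] at this; revert this; decide
  have rD1 : rkf φ (Y ∩ Z) + 1 ≤ rkf φ Z := by
    rw [← rkf_insert_succ φ hbD]
    apply rkf_mono
    intro x hx; rw [hZeq]; grind
  have haC : φ a ∉ spn φ (Y ∩ W) := by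
    intro hc; have := fun_span φ gC hc; rw [gX a haX.1] at this; revert this; decide
  have rC1 : rkf φ (Y ∩ W) + 1 ≤ rkf φ W := by
    rw [← rkf_insert_succ φ haC]
    apply rkf_mono
    intro x hx; rw [hWeq]; grind
  have rZ : 4 ≤ rkf φ Z := by
    by_contra hc
    obtain ⟨p, hp, hp1⟩ := H.funct k (by have := k.rX; omega)
    have h1 := hp1 f (hXE hf) (H.notin k.symm)
    have h2 := hp1 e heE neW
    have hb1 : p (φ b) = 1 := by
      have h5 := congrArg p hq
      rw [map_add, map_add, map_add, h1, hp a haX.2, hp a' haX'.2, map_zero] at h5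
      rcases zm_cases (p (φ b)) with h6 | h6
      · rw [h6] at h5; exfalso; revert h5; decide
      · exact h6
    have h6 := H.affine2 (S := (Y ∩ Z).filter (fun x => p (φ x) = 1))
      (by intro x hx; simp at hx; exact hYE hx.1.1)
      (by have := rkf_mono φ (Finset.filter_subset (fun x => p (φ x) = 1) (Y ∩ Z)); omega)
      (g := p) (by intro x hx; exact (Finset.mem_filter.1 hx).2)
    have h7 := H.fcoc (g := g + p) (hXE haX.1) (by simp [gX a haX.1, hp a haX.2])
      (insert a (insert a' ((Y ∩ Z).filter (fun x => p (φ x) = 1)))) (by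
        intro x hx hgx
        rw [LinearMap.add_apply] at hgx
        by_cases hxX : x ∈ X
        · rw [hX] at hxX
          simp only [Finset.mem_insert, Finset.mem_singleton] at hxX
          rcases hxX with rfl | rfl | rfl | rfl
          · rw [gX _ hf, h1] at hgx; exfalso; revert hgx; decide
          · rw [gX _ hbX.1, hb1] at hgx; exfalso; revert hgx; decide
          · simp
          · simp
        · by_cases hxe : x = e
          · rw [hxe, ge, h2] at hgx; exfalso; revert hgx; decide
          · have hxY : x ∈ Y := by have := (h.cov x).1 hx; tauto
            rw [gY x hxY, zero_add] at hgx
            have hxW : x ∉ W := by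
              intro hw; rw [hp x hw] at hgx; revert hgx; decide
            have hxZ : x ∈ Z := by
              have := (k.cov x).1 hx
              rcases this with rfl | h8 | h8
              · exact absurd hf hxX
              · exact h8
              · exact absurd h8 hxW
            simp [hxY, hxZ, hgx])
    have h8 := Finset.card_insert_le a (insert a' ((Y ∩ Z).filter (fun x => p (φ x) = 1)))
    have h9 := Finset.card_insert_le a' ((Y ∩ Z).filter (fun x => p (φ x) = 1))
    omega
  have cW := H.card7 k.symm rW
  have cZ := H.card7 k rZ
  have cC : W.card ≤ (Y ∩ W).card + 2 := by
    conv_lhs => rw [hWeq]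
    exact (Finset.card_insert_le _ _).trans (by
      have := Finset.card_insert_le a' (Y ∩ W); omega)
  have cD : Z.card ≤ (Y ∩ Z).card + 2 := by
    conv_lhs => rw [hZeq]
    exact (Finset.card_insert_le _ _).trans (by
      have := Finset.card_insert_le b (Y ∩ Z); omega)
  have hCE : Y ∩ W ⊆ E := fun a ha => hYE (Finset.mem_inter.1 ha).1
  have hDE : Y ∩ Z ⊆ E := fun a ha => hYE (Finset.mem_inter.1 ha).1
  have rC3 : 3 ≤ rkf φ (Y ∩ W) := by
    by_contra hc
    have := H.card_le3 hCE (by omega); omega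
  have rD3 : 3 ≤ rkf φ (Y ∩ Z) := by
    by_contra hc
    have := H.card_le3 hDE (by omega); omega
  have rWC : rkf φ W ≤ rkf φ (Y ∩ W) + 1 := by
    have h1 := H.conn (Y ∩ W) (insert f (insert a (insert a' Z))) (by
        intro x; have := h.cov x; have := k.cov x
        have : x ∈ W ↔ x ∈ insert a (insert a' (Y ∩ W)) := by rw [← hWeq]
        grind) (by
        intro x hx hx2
        have := k.dj x; have := h.dj x; grind) rC3 (k.rX.trans (rkf_mono φ (by intro x; grind)))
    have h2 : φ f ∈ spn φ (insert a (insert a' Z)) :=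
      quad_mem hq (mem_spn φ (by grind)) (mem_spn φ (by grind)) (mem_spn φ (by grind))
    rw [rkf_insert_eq φ h2] at h1
    have h3 := rkf_insert_le φ (insert a' Z) a
    have h4 := rkf_insert_le φ Z a'
    omega
  have rZD : rkf φ Z ≤ rkf φ (Y ∩ Z) + 1 := by
    have h1 := H.conn (Y ∩ Z) (insert b (insert e (insert f W))) (by
        intro x; have := h.cov x; have := k.cov x
        have : x ∈ Z ↔ x ∈ insert e (insert b (Y ∩ Z)) := by rw [← hZeq]
        grind) (by
        intro x hx hx2
        have := k.dj x; have := h.dj x; have := h.heY; grind) rD3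
          (k.rY.trans (rkf_mono φ (by intro x; grind)))
    have h2 : φ b ∈ spn φ (insert e (insert f W)) :=
      quad_mem (q := φ f) (s := φ a) (t := φ a') (by rw [← hq]; abel)
        (mem_spn φ (by grind)) (mem_spn φ (by grind)) (mem_spn φ (by grind))
    rw [rkf_insert_eq φ h2] at h1
    have h3 := rkf_insert_le φ (insert f W) e
    have h4 := rkf_insert_le φ W f
    omega
  refine ⟨b, hbX.1, Y ∩ W, Y ∩ Z, hbf, ?_, ?_, ?_, ?_, by omega, by omega, by omega⟩
  · intro x
    have := h.cov x; have := k.cov x; have := h.dj x; grind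
  · intro x hx hx2; have := k.dj x; grind
  · exact pair_mem φ gD ge (gX b hbX.1) (by rw [← hZeq]; exact rZD)
  · exact quad_pair hq (pair_mem φ gC (gX a haX.1) (gX a' haX'.1) (by rw [← hWeq]; exact rWC))

/-- adding `X` to a span containing the sum of two of its elements -/
theorem rkf_quad (φ : α → V) {S X : Finset α} {u v : α} (hu : u ∈ X) (hv : v ∈ X) (huv : u ≠ v)
    (hc : X.card = 4) (hsum : ∑ x ∈ X, φ x = 0) (h : φ u + φ v ∈ spn φ S) :
    rkf φ (S ∪ X) ≤ rkf φ S + 2 := by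
  have c2 : ((X.erase u).erase v).card = 2 := by
    rw [Finset.card_erase_of_mem (by grind), Finset.card_erase_of_mem hu, hc]
  have s2 := hsum
  rw [← Finset.add_sum_erase X φ hu, ← Finset.add_sum_erase (X.erase u) φ (a := v) (by grind)] at s2
  have hX : X = insert u (insert v ((X.erase u).erase v)) := by ext x; grind
  obtain ⟨s, t, hst, h2⟩ := Finset.card_eq_two.1 c2
  rw [h2, Finset.sum_insert (by simp [hst]), Finset.sum_singleton] at s2
  rw [h2] at hX
  have h3 : rkf φ (S ∪ X) ≤ rkf φ (insert u (insert s S)) := by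
    apply rkf_le_of
    intro x hx
    have m1 : φ u ∈ spn φ (insert u (insert s S)) := mem_spn φ (by grind)
    have m2 : φ s ∈ spn φ (insert u (insert s S)) := mem_spn φ (by grind)
    have m0 : φ u + φ v ∈ spn φ (insert u (insert s S)) := spn_mono φ (by intro x; grind) h
    have m3 : φ v ∈ spn φ (insert u (insert s S)) := by
      have := sub_mem m0 m1; rwa [add_sub_cancel_left] at this
    rcases Finset.mem_union.1 hx with hx | hx
    · exact mem_spn φ (by grind)
    · rw [hX] at hx
      simp only [Finset.mem_insert, Finset.mem_singleton] at hx
      rcases hx with rfl | rfl | rfl | rfl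
      · exact m1
      · exact m3
      · exact m2
      · exact quad_mem (by rw [← s2]; abel) m1 m2 m3
  have h4 := rkf_insert_le φ (insert s S) u
  have h5 := rkf_insert_le φ S s
  omega

/-- off-diagonal intersection -/
theorem FHyp.diag2 (H : FHyp φ E) {e : α} {X Y : Finset α} {g : V →ₗ[ZMod 2] ZMod 2}
    (c : FCtx φ E e X Y g) {S T : Finset α} (hY : ∀ a, a ∈ Y ↔ a ∈ S ∨ a ∈ T) (hd : ∀ a ∈ S, a ∉ T)
    {u v w : α} (hu : u ∈ X) (hv : v ∈ X) (huv : u ≠ v) (h : φ u + φ v ∈ spn φ T) (hw : w ∈ X)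
    (hew : φ e + φ w ∈ spn φ T) (hS : 3 ≤ rkf φ S) : rkf φ E + 1 ≤ rkf φ S + rkf φ T := by
  have h1 := rkf_quad φ hu hv huv c.card c.sum h
  have h2 : φ e ∈ spn φ (T ∪ X) := by
    have m1 := spn_mono φ (T := T ∪ X) Finset.subset_union_left hew
    have m2 : φ w ∈ spn φ (T ∪ X) := mem_spn φ (by grind)
    have := sub_mem m1 m2
    rwa [add_sub_cancel_right] at this
  have h3 := rkf_insert_eq φ h2
  have hh := c.h
  have h4 := H.conn S (insert e (T ∪ X)) (by
    intro a; have := hh.cov a; have := hY a; grind) (by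
    intro a ha; have := hY a; have := hh.dj a; have := hh.heY; grind) hS
    (hh.rX.trans (rkf_mono φ (by intro x; grind)))
  omega

theorem FHyp.diag1 (H : FHyp φ E) {e : α} {X Y : Finset α} {g : V →ₗ[ZMod 2] ZMod 2}
    (c : FCtx φ E e X Y g) {C D C' D' : Finset α} (hY : ∀ a, a ∈ Y ↔ a ∈ C ∨ a ∈ D)
    (hY' : ∀ a, a ∈ Y ↔ a ∈ C' ∨ a ∈ D') (hd : ∀ a ∈ C, a ∉ D) (hd' : ∀ a ∈ C', a ∉ D')
    {f b b' : α} (hf : f ∈ X) (hb : b ∈ X) (hb' : b' ∈ X) (hbf : b ≠ f) (hbb : b' ≠ b)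
    (r1 : rkf φ C + rkf φ D ≤ rkf φ E) (r2 : rkf φ C' + rkf φ D' ≤ rkf φ E)
    (m1 : φ e + φ b ∈ spn φ D) (m2 : φ e + φ b' ∈ spn φ D') (m3 : φ f + φ b ∈ spn φ C)
    (hC : 2 ≤ rkf φ (C ∩ C')) (hD : 2 ≤ rkf φ (D ∩ D')) : False := by
  obtain ⟨h, card, gX, ge, gY, sum, nosep⟩ := c
  have hne : ∀ S : Finset α, S ⊆ Y → ∀ x, g (φ x) = 1 → rkf φ (insert x S) = rkf φ S + 1 := by
    intro S hS x hx
    apply rkf_insert_succ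
    intro hc
    have := fun_span φ (fun y hy => gY y (hS hy)) hc
    rw [hx] at this; revert this; decide
  have hDY : D ∩ D' ⊆ Y := by intro a ha; rw [hY]; grind
  have hCY : C ∩ C' ⊆ Y := by intro a ha; rw [hY]; grind
  have e1 := hne _ hDY e ge
  have h1 := rkf_quad φ (S := C ∪ C') hf hb hbf.symm card sum
    (spn_mono φ Finset.subset_union_left m3)
  have h2 := H.conn (insert e (D ∩ D')) ((C ∪ C') ∪ X) (by
    intro a; have := h.cov a; have := hY a; have := hY' a; grind) (by
    intro a ha; have := hY a; have := hY' a; have := h.dj a; have := h.heY; have := h.heX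
    have := hd a; have := hd' a; grind) (by omega) (h.rX.trans (rkf_mono φ (by intro x; grind)))
  have s1 := rkf_submod φ C C'
  have s2 := rkf_submod φ D D'
  have c2 : ((X.erase b).erase b').card = 2 := by
    rw [Finset.card_erase_of_mem (by grind), Finset.card_erase_of_mem hb, card]
  have hX : X = insert b (insert b' ((X.erase b).erase b')) := by ext x; grind
  obtain ⟨x, w, hxw, h3⟩ := Finset.card_eq_two.1 c2
  have hx : x ∈ (X.erase b).erase b' := by rw [h3]; simp
  have hw : w ∈ (X.erase b).erase b' := by rw [h3]; simp
  simp only [Finset.mem_erase] at hx hw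
  have hXm : ∀ y, y ∈ X ↔ y = b ∨ y = b' ∨ y = x ∨ y = w := by
    intro y; rw [h3] at hX; rw [hX]; simp
  have e2 := hne _ hCY x (gX x hx.2.2)
  have e3 : rkf φ (insert b (insert b' (insert e (D ∪ D')))) ≤ rkf φ (D ∪ D') + 1 := by
    refine le_trans (rkf_le_of φ (T := insert e (D ∪ D')) ?_) (rkf_insert_le φ _ _)
    have me : φ e ∈ spn φ (insert e (D ∪ D')) := mem_spn φ (by grind)
    have k1 := sub_mem (spn_mono φ (T := insert e (D ∪ D')) (by intro x; grind) m1) me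
    have k2 := sub_mem (spn_mono φ (T := insert e (D ∪ D')) (by intro x; grind) m2) me
    rw [add_sub_cancel_left] at k1 k2
    intro y hy
    rw [Finset.mem_insert, Finset.mem_insert] at hy
    rcases hy with rfl | rfl | hy
    · exact k1
    · exact k2
    · exact mem_spn φ hy
  have sep : FSep φ E w (insert b (insert b' (insert e (D ∪ D')))) (insert x (C ∩ C')) := by
    have hwY : w ∉ Y := h.dj w hw.2.2
    have hwe : w ≠ e := fun hh => h.heX (hh ▸ hw.2.2)
    have hxe : x ≠ e := fun hh => h.heX (hh ▸ hx.2.2)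
    have hxY : x ∉ Y := h.dj x hx.2.2
    have hbY : b ∉ Y := h.dj b hb
    have hbY' : b' ∉ Y := h.dj b' hb'
    have heY := h.heY
    refine ⟨?_, ?_, ?_, ?_, ?_, by omega, by omega⟩
    · have := hY w; have := hY' w; grind
    · have := hY w; grind
    · intro a ha hb2
      have q1 := hY a; have q2 := hY' a; have q3 := hd a; have q4 := hd' a
      simp only [Finset.mem_insert, Finset.mem_union, Finset.mem_inter] at ha hb2
      rcases hb2 with rfl | ⟨t1, t2⟩
      · rcases ha with rfl | rfl | rfl | t | t
        · exact hx.2.1 rfl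
        · exact hx.1 rfl
        · exact hxe rfl
        · exact hxY (q1.2 (Or.inr t))
        · exact hxY (q2.2 (Or.inr t))
      · have t3 := q1.2 (Or.inl t1)
        rcases ha with rfl | rfl | rfl | t | t
        · exact hbY t3
        · exact hbY' t3
        · exact heY t3
        · exact q3 t1 t
        · exact q4 t2 t
    · intro a; have := hY a; have := hY' a; have := h.cov a; have := hXm a; grind
    · have := rkf_mono φ (S := insert e (D ∩ D'))
        (T := insert b (insert b' (insert e (D ∪ D')))) (by intro x; grind)
      omega
  have hfin := (nosep w hw.2.2 _ _ sep (by simp)).1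
  have : ({b, b'} : Finset α) ⊆ X ∩ insert b (insert b' (insert e (D ∪ D'))) := by
    intro y; grind
  have := Finset.card_le_card this
  rw [Finset.card_pair hbb.symm] at this
  omega

theorem FHyp.false (H : FHyp φ E) (hne : E.Nonempty) : False := by
  obtain ⟨e, X, Y, g, c⟩ := H.exists_ctx hne
  have hYE := H.sub c.h.symm
  have hXne : X.Nonempty := by rw [← Finset.card_pos, c.card]; norm_num
  obtain ⟨f, hf⟩ := hXne
  obtain ⟨b, hb, C, D, hbf, hY, hd, m1, m3, r1, cC, cD⟩ := H.perF c hf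
  obtain ⟨b', hb', C', D', hbb, hY', hd', m1', m3', r1', cC', cD'⟩ := H.perF c hb
  have d1 : rkf φ (C ∩ C') ≤ 1 ∨ rkf φ (D ∩ D') ≤ 1 := by
    by_contra! hc
    exact H.diag1 c hY hY' hd hd' hf hb hb' hbf hbb r1 r1' m1 m1' m3 (by omega) (by omega)
  have d2 : rkf φ (C ∩ D') ≤ 2 ∨ rkf φ (D ∩ C') ≤ 2 := by
    by_contra! hc
    have k1 := H.diag2 c (S := C ∩ D') (T := D ∪ C') (by
      intro a; have := hY a; have := hY' a; grind) (by
      intro a; have := hY a; have := hd a; have := hd' a; grind) hb hb' hbb.symm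
      (spn_mono φ (by intro x; grind) m3') hb (spn_mono φ (by intro x; grind) m1) (by omega)
    have k2 := H.diag2 c (S := D ∩ C') (T := C ∪ D') (by
      intro a; have := hY a; have := hY' a; grind) (by
      intro a; have := hY a; have := hd a; have := hd' a; grind) hf hb hbf.symm
      (spn_mono φ (by intro x; grind) m3) hb' (spn_mono φ (by intro x; grind) m1') (by omega)
    have s1 := rkf_submod φ C D'
    have s2 := rkf_submod φ D C'
    omega
  have hCE : C ⊆ E := fun a ha => hYE ((hY a).2 (Or.inl ha))
  have hDE : D ⊆ E := fun a ha => hYE ((hY a).2 (Or.inr ha))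
  have q1 : C.card ≤ (C ∩ C').card + (C ∩ D').card := by
    refine le_trans (Finset.card_le_card ?_) (Finset.card_union_le _ _)
    intro a; have := hY a; have := hY' a; grind
  have q2 : D.card ≤ (D ∩ C').card + (D ∩ D').card := by
    refine le_trans (Finset.card_le_card ?_) (Finset.card_union_le _ _)
    intro a; have := hY a; have := hY' a; grind
  have q3 : C'.card ≤ (C ∩ C').card + (D ∩ C').card := by
    refine le_trans (Finset.card_le_card ?_) (Finset.card_union_le _ _)
    intro a; have := hY a; have := hY' a; grind
  have q4 : D'.card ≤ (C ∩ D').card + (D ∩ D').card := by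
    refine le_trans (Finset.card_le_card ?_) (Finset.card_union_le _ _)
    intro a; have := hY a; have := hY' a; grind
  have n1 : C ∩ C' ⊆ E := fun a ha => hCE (Finset.mem_inter.1 ha).1
  have n2 : C ∩ D' ⊆ E := fun a ha => hCE (Finset.mem_inter.1 ha).1
  have n3 : D ∩ C' ⊆ E := fun a ha => hDE (Finset.mem_inter.1 ha).1
  have n4 : D ∩ D' ⊆ E := fun a ha => hDE (Finset.mem_inter.1 ha).1
  rcases d1 with d1 | d1
  · have t1 := H.card_le1 n1 d1
    rcases d2 with d2 | d2
    · have := H.card_le3 n2 d2; omega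
    · have := H.card_le3 n3 d2; omega
  · have t1 := H.card_le1 n4 d1
    rcases d2 with d2 | d2
    · have := H.card_le3 n2 d2; omega
    · have := H.card_le3 n3 d2; omega

end coreD

section coreE
open Classical

variable {V : Type*} [AddCommGroup V] [Module (ZMod 2) V]
variable {φ : α → V} {E : Finset α}

theorem exists_min_cod (φ : α → V) (E : Finset α) (T : Finset α) :
    rkf φ (E \ T) < rkf φ E → ∃ T' ⊆ T, rkf φ (E \ T') < rkf φ E ∧
      ∀ t ∈ T', rkf φ (E \ (T'.erase t)) = rkf φ E := by
  induction T using Finset.strongInduction with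
  | H T ih =>
    intro h
    by_cases hc : ∃ t ∈ T, rkf φ (E \ (T.erase t)) ≠ rkf φ E
    · obtain ⟨t, ht, hne⟩ := hc
      have h1 : rkf φ (E \ (T.erase t)) ≤ rkf φ E := rkf_mono φ Finset.sdiff_subset
      obtain ⟨T', h2, h3⟩ := ih _ (Finset.erase_ssubset ht) (by omega)
      exact ⟨T', h2.trans (Finset.erase_subset _ _), h3⟩
    · push Not at hc
      exact ⟨T, subset_rfl, h, hc⟩

/-- connectivity hypothesis in finite form -/
def FConn (φ : α → V) (E : Finset α) : Prop :=
  ∀ j, 1 ≤ j → j ≤ 3 → ∀ S T : Finset α, (∀ a, a ∈ E ↔ a ∈ S ∨ a ∈ T) → (∀ a ∈ S, a ∉ T) →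
    j ≤ rkf φ S → j ≤ rkf φ T → rkf φ E + j ≤ rkf φ S + rkf φ T

/-- minimality hypothesis in finite form -/
def FMinim (φ : α → V) (E : Finset α) : Prop :=
  ∀ e ∈ E, ∃ j, ∃ X Y : Finset α, 1 ≤ j ∧ j ≤ 3 ∧ e ∉ X ∧ e ∉ Y ∧ (∀ a ∈ X, a ∉ Y) ∧
    (∀ a, a ∈ E ↔ a = e ∨ a ∈ X ∨ a ∈ Y) ∧ j ≤ rkf φ X ∧ j ≤ rkf φ Y ∧
    rkf φ X + rkf φ Y < rkf φ (E.erase e) + j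

theorem min_cod_card (conn : FConn φ E) (hr : 4 ≤ rkf φ E)
    (hno : ¬ ∃ T ⊆ E, T.card = 4 ∧ rkf φ (E \ T) < rkf φ E ∧
      ∀ t ∈ T, rkf φ (E \ (T.erase t)) = rkf φ E)
    {T : Finset α} (hT : T ⊆ E) (h : rkf φ (E \ T) < rkf φ E) : 5 ≤ T.card := by
  obtain ⟨T', hTT, h1, h2⟩ := exists_min_cod φ E T h
  have hle := Finset.card_le_card hTT
  by_contra hc
  have hn : T'.Nonempty := by
    rw [Finset.nonempty_iff_ne_empty]; rintro rfl; simp at h1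
  obtain ⟨t, ht⟩ := hn
  have h3 := h2 t ht
  have h4 : rkf φ (E \ (T'.erase t)) ≤ rkf φ (insert t (E \ T')) := rkf_mono φ (by
    intro x; grind)
  have h5 := rkf_insert_le φ (E \ T') t
  have h6 : T'.card ≠ 4 := fun h => hno ⟨T', hTT.trans hT, h, h1, h2⟩
  have h7 := rkf_le_card φ T'
  have h8 := rkf_union_le φ (E \ T') T'
  rw [Finset.sdiff_union_of_subset (hTT.trans hT)] at h8
  have h9 := conn (rkf φ T') (by omega) (by omega) T' (E \ T') (by
    intro a; have := @hTT a; have := @hT a; grind) (by intro a; grind) le_rfl (by omega)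
  omega

theorem min_sep (conn : FConn φ E) (hr : 4 ≤ rkf φ E) (hmin : FMinim φ E) {e : α} (he : e ∈ E) :
    ∃ X Y, FSep φ E e X Y := by
  obtain ⟨j, X, Y, j1, j3, heX, heY, dj, cov, rX, rY, hs⟩ := hmin e he
  have hle : rkf φ (E.erase e) ≤ rkf φ E := rkf_mono φ (Finset.erase_subset _ _)
  have eX : E = insert e X ∪ Y := by ext a; rw [cov]; grind
  have eY : E = X ∪ insert e Y := by ext a; rw [cov]; grind
  have uX := rkf_union_le φ (insert e X) Y
  have uY := rkf_union_le φ X (insert e Y)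
  rw [← eX] at uX
  rw [← eY] at uY
  have iX := rkf_insert_le φ X e
  have iY := rkf_insert_le φ Y e
  have mX : rkf φ X ≤ rkf φ (insert e X) := rkf_mono φ (Finset.subset_insert _ _)
  have mY : rkf φ Y ≤ rkf φ (insert e Y) := rkf_mono φ (Finset.subset_insert _ _)
  have cX : ∀ i, 1 ≤ i → i ≤ 3 → i ≤ rkf φ (insert e X) → i ≤ rkf φ Y →
      rkf φ E + i ≤ rkf φ (insert e X) + rkf φ Y := fun i h1 h2 h3 h4 =>
    conn i h1 h2 _ _ (by intro a; rw [cov]; grind) (by intro a; have := dj a; grind) h3 h4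
  have cY : ∀ i, 1 ≤ i → i ≤ 3 → i ≤ rkf φ X → i ≤ rkf φ (insert e Y) →
      rkf φ E + i ≤ rkf φ X + rkf φ (insert e Y) := fun i h1 h2 h3 h4 =>
    conn i h1 h2 _ _ (by intro a; rw [cov]; grind) (by intro a; have := dj a; grind) h3 h4
  by_cases hj : j = 3
  · subst hj
    exact ⟨X, Y, heX, heY, dj, cov, rX, rY, by omega⟩
  · exfalso
    have a1 := cX j j1 j3 (by omega) rY
    have a2 := cY j j1 j3 rX (by omega)
    have a3 := cX (j+1) (by omega) (by omega) (by omega)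
    have a4 := fun h => cY (j+1) (by omega) (by omega) h (by omega)
    have a5 : rkf φ Y ≤ j := by
      by_contra h; have := a3 (by omega); omega
    have a6 : rkf φ X ≤ j := by
      by_contra h; have := a4 (by omega); omega
    omega

theorem core_ge4 (inj : ∀ x ∈ E, ∀ y ∈ E, φ x = φ y → x = y) (nz : ∀ x ∈ E, φ x ≠ 0)
    (conn : FConn φ E) (hmin : FMinim φ E) (hr : 4 ≤ rkf φ E) :
    ∃ T ⊆ E, T.card = 4 ∧ rkf φ (E \ T) < rkf φ E ∧
      ∀ t ∈ T, rkf φ (E \ (T.erase t)) = rkf φ E := by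
  by_contra hno
  have H : FHyp φ E := ⟨inj, nz, fun S T h1 h2 h3 h4 => conn 3 (by omega) le_rfl S T h1 h2 h3 h4,
    fun e he => min_sep conn hr hmin he, by
      intro S T h1 h2
      have h3 : rkf φ (E \ (T ∩ E)) ≤ rkf φ S := rkf_mono φ (by
        intro a; have := h1 a; grind)
      have h4 := min_cod_card conn hr hno (T := T ∩ E) Finset.inter_subset_right (by omega)
      have := Finset.card_le_card (Finset.inter_subset_left (s₁ := T) (s₂ := E))
      omega⟩
  apply H.false
  rw [Finset.nonempty_iff_ne_empty]
  rintro rfl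
  have := rkf_le_card φ (∅ : Finset α)
  simp at this; omega

theorem core_3 (inj : ∀ x ∈ E, ∀ y ∈ E, φ x = φ y → x = y) (nz : ∀ x ∈ E, φ x ≠ 0)
    (hr : rkf φ E = 3) (hc : 6 ≤ E.card) :
    ∃ T ⊆ E, T.card = 4 ∧ rkf φ (E \ T) < rkf φ E ∧
      ∀ t ∈ T, rkf φ (E \ (T.erase t)) = rkf φ E := by
  have hfin : ((spn φ E : Set V)).Finite := Set.finite_coe_iff.1 (spn_finite φ E)
  set W : Finset V := hfin.toFinset with hW
  have mW : ∀ v, v ∈ W ↔ v ∈ spn φ E := by intro v; simp [hW]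
  have cW : W.card = 8 := by
    have h := card_spn φ E
    rw [hr] at h
    have h2 : Nat.card (spn φ E) = (spn φ E : Set V).ncard := rfl
    rw [h2, Set.ncard_eq_toFinset_card _ hfin] at h
    rw [hW, h]; norm_num
  have cI : (E.image φ).card = E.card := Finset.card_image_of_injOn (by
    intro x hx y hy hxy; exact inj x hx y hy hxy)
  have hI : insert 0 (E.image φ) ⊆ W := by
    intro v hv
    rw [mW]
    rcases Finset.mem_insert.1 hv with rfl | hv
    · exact zero_mem _
    · obtain ⟨x, hx, rfl⟩ := Finset.mem_image.1 hv
      exact mem_spn φ hx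
  have c0 : (insert 0 (E.image φ)).card = E.card + 1 := by
    rw [Finset.card_insert_of_notMem, cI]
    intro h
    obtain ⟨x, hx, h⟩ := Finset.mem_image.1 h
    exact nz x hx h
  have cm : (W \ insert 0 (E.image φ)).card ≤ 1 := by
    rw [Finset.card_sdiff_of_subset hI]; omega
  have hp : ∃ p : V, ∀ v ∈ spn φ E, v ≠ 0 → v ≠ p → ∃ x ∈ E, φ x = v := by
    rcases Finset.eq_empty_or_nonempty (W \ insert 0 (E.image φ)) with h | ⟨p, hp⟩
    · refine ⟨0, fun v hv h0 _ => ?_⟩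
      by_contra hc
      have : v ∈ W \ insert 0 (E.image φ) := by
        rw [Finset.mem_sdiff, mW, Finset.mem_insert, Finset.mem_image, not_or]
        exact ⟨hv, h0, hc⟩
      rw [h] at this; simp at this
    · refine ⟨p, fun v hv h0 hvp => ?_⟩
      by_contra hc
      have : v ∈ W \ insert 0 (E.image φ) := by
        rw [Finset.mem_sdiff, mW, Finset.mem_insert, Finset.mem_image, not_or]
        exact ⟨hv, h0, hc⟩
      exact hvp (Finset.card_le_one.1 cm v this p hp)
  obtain ⟨p, hp⟩ := hp
  have he : ∃ e ∈ E, φ e ∉ Submodule.span (ZMod 2) {p} := by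
    by_contra! hc
    have h1 := Submodule.finrank_mono (spn_le φ hc)
    have h2 := finrank_span_le_card (R := ZMod 2) ({p} : Set V)
    simp at h2
    have : rkf φ E = Module.finrank (ZMod 2) (spn φ E) := rfl
    omega
  obtain ⟨e, heE, he⟩ := he
  obtain ⟨g, hg, hle⟩ := Submodule.exists_le_ker_of_notMem he
  have hgp : g p = 0 := hle (Submodule.mem_span_singleton_self p)
  have hge : g (φ e) = 1 := (zm_cases _).resolve_left hg
  set T := E.filter (fun x => g (φ x) = 1) with hT
  have hTE : T ⊆ E := Finset.filter_subset _ _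
  have key : ∀ v ∈ spn φ E, g v = 1 → v ∈ T.image φ := by
    intro v hv h1
    obtain ⟨x, hx, rfl⟩ := hp v hv (by rintro rfl; simp at h1)
      (by rintro rfl; rw [hgp] at h1; revert h1; decide)
    exact Finset.mem_image_of_mem _ (by rw [hT, Finset.mem_filter]; exact ⟨hx, h1⟩)
  have c8 : W ⊆ T.image φ ∪ T.image (fun x => φ x + φ e) := by
    intro v hv
    rw [mW] at hv
    rw [Finset.mem_union]
    rcases zm_cases (g v) with h | h
    · right
      have := key (v + φ e) (add_mem hv (mem_spn φ heE)) (by rw [map_add, h, hge, zero_add])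
      obtain ⟨x, hx, h2⟩ := Finset.mem_image.1 this
      refine Finset.mem_image.2 ⟨x, hx, ?_⟩
      rw [h2, add_assoc, add_self2, add_zero]
    · left; exact key v hv h
  have c9 := (Finset.card_le_card c8).trans (Finset.card_union_le _ _)
  have c10 := Finset.card_image_le (s := T) (f := φ)
  have c11 := Finset.card_image_le (s := T) (f := fun x => φ x + φ e)
  have c12 := card_affine φ (S := T) (fun x hx y hy => inj x (hTE hx) y (hTE hy)) (g := g)
    (by intro x hx; exact (Finset.mem_filter.1 hx).2)
  have c13 := rkf_mono φ hTE
  have c14 : 2 ^ rkf φ T ≤ 2 ^ 3 := Nat.pow_le_pow_right (by norm_num) (by omega)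
  have cT : T.card = 4 := by omega
  have hg0 : ∀ y ∈ E \ T, g (φ y) = 0 := by
    intro y hy
    rw [Finset.mem_sdiff, hT, Finset.mem_filter] at hy
    rcases zm_cases (g (φ y)) with h | h
    · exact h
    · exact absurd ⟨hy.1, h⟩ hy.2
  have hins : ∀ t ∈ T, rkf φ (insert t (E \ T)) = rkf φ (E \ T) + 1 := by
    intro t ht
    apply rkf_insert_succ
    intro hc
    have h1 := fun_span φ hg0 hc
    rw [(Finset.mem_filter.1 ht).2] at h1
    revert h1; decide
  have heT : e ∈ T := by rw [hT, Finset.mem_filter]; exact ⟨heE, hge⟩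
  have hinsle : ∀ t ∈ T, rkf φ (insert t (E \ T)) ≤ rkf φ E := fun t ht => rkf_mono φ (by
    intro x hx
    rcases Finset.mem_insert.1 hx with rfl | hx
    · exact hTE ht
    · exact (Finset.mem_sdiff.1 hx).1)
  have r2 : 2 ≤ rkf φ (E \ T) := by
    have h1 := card_lt_pow φ (S := E \ T) (fun x hx y hy => inj x (Finset.mem_sdiff.1 hx).1 y
      (Finset.mem_sdiff.1 hy).1) (fun x hx => nz x (Finset.mem_sdiff.1 hx).1)
    rw [Finset.card_sdiff_of_subset hTE, cT] at h1
    by_contra hlt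
    have h2 : 2 ^ rkf φ (E \ T) ≤ 2 ^ 1 := Nat.pow_le_pow_right (by norm_num) (by omega)
    omega
  refine ⟨T, hTE, cT, ?_, ?_⟩
  · have := hins e heT; have := hinsle e heT; omega
  · intro t ht
    have h1 := hins t ht
    have h2 : rkf φ (insert t (E \ T)) ≤ rkf φ (E \ (T.erase t)) := rkf_mono φ (by
      intro x hx
      rw [Finset.mem_sdiff, Finset.mem_erase]
      rcases Finset.mem_insert.1 hx with rfl | hx
      · exact ⟨hTE ht, fun h => h.1 rfl⟩
      · exact ⟨(Finset.mem_sdiff.1 hx).1, fun h => (Finset.mem_sdiff.1 hx).2 h.2⟩)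
    have h3 : rkf φ (E \ (T.erase t)) ≤ rkf φ E := rkf_mono φ Finset.sdiff_subset
    omega

theorem core_main (inj : ∀ x ∈ E, ∀ y ∈ E, φ x = φ y → x = y) (nz : ∀ x ∈ E, φ x ≠ 0)
    (conn : FConn φ E) (hmin : FMinim φ E) (hc : 6 ≤ E.card) :
    ∃ T ⊆ E, T.card = 4 ∧ rkf φ (E \ T) < rkf φ E ∧
      ∀ t ∈ T, rkf φ (E \ (T.erase t)) = rkf φ E := by
  have h := card_lt_pow φ inj nz
  rcases Nat.lt_or_ge (rkf φ E) 4 with h1 | h1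
  · have h2 : rkf φ E = 3 := by
      have h3 : rkf φ E = 0 ∨ rkf φ E = 1 ∨ rkf φ E = 2 ∨ rkf φ E = 3 := by omega
      rcases h3 with h3 | h3 | h3 | h3
      · rw [h3] at h; omega
      · rw [h3] at h; omega
      · rw [h3] at h; omega
      · exact h3
    exact core_3 inj nz h2 hc
  · exact core_ge4 inj nz conn hmin h1
end coreE

section transfer
open Classical

theorem mrk_eq_eRk (M : Matroid α) (X : Set α) : mrk M X = M.eRk X := by
  apply le_antisymm
  · refine iSup₂_le ?_
    rintro I ⟨h1, h2⟩
    exact h1.encard_le_eRk_of_subset h2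
  · obtain ⟨I, h1, h2, h3⟩ := Matroid.le_eRk_iff.1 (le_refl (M.eRk X))
    rw [← h3]
    exact le_iSup₂ (f := fun (I : Set α) (_ : I ∈ {I : Set α | M.Indep I ∧ I ⊆ X}) => I.encard)
      I ⟨h2, h1⟩

theorem mdel_mrk (M : Matroid α) (e : α) {X : Set α} (h : X ⊆ M.E \ {e}) :
    mrk (mdel M {e}) X = M.eRk X := by
  rw [mrk_eq_eRk, mdel, Matroid.restrict_eRk_eq _ h]

theorem vsep_iff (M : Matroid α) (j : ℕ) {X Y : Set α} (h : X ∪ Y = M.E) (hd : Disjoint X Y) :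
    IsVSep M j X Y ↔ M.eRk X + M.eRk Y - M.eRk M.E < j ∧ (j : ℕ∞) ≤ M.eRk X ∧
      (j : ℕ∞) ≤ M.eRk Y := by
  have hY : M.E \ X = Y := by
    rw [← h, Set.union_sdiff_left, hd.symm.sdiff_eq_left]
  unfold IsVSep lam mrank
  rw [hY]
  simp only [mrk_eq_eRk]
  tauto

theorem vsep_del_iff (M : Matroid α) (j : ℕ) (e : α) {X Y : Set α} (h : X ∪ Y = M.E \ {e})
    (hd : Disjoint X Y) :
    IsVSep (mdel M {e}) j X Y ↔ M.eRk X + M.eRk Y - M.eRk (M.E \ {e}) < j ∧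
      (j : ℕ∞) ≤ M.eRk X ∧ (j : ℕ∞) ≤ M.eRk Y := by
  rw [vsep_iff _ _ (by exact h) hd]
  rw [← mrk_eq_eRk, ← mrk_eq_eRk, ← mrk_eq_eRk]
  rw [mdel_mrk, mdel_mrk, mdel_mrk]
  · rfl
  · exact subset_rfl
  · rw [← h]; exact Set.subset_union_right
  · rw [← h]; exact Set.subset_union_left

theorem rank_ne_top {M : Matroid α} (hM : VertConn M 4) : M.eRk M.E ≠ ⊤ := by
  intro ht
  obtain ⟨B, hB⟩ := M.exists_isBase
  have hBt : B.encard = ⊤ := by rw [hB.encard_eq_eRank, ← Matroid.eRk_ground, ht]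
  have hinf : B.Infinite := Set.encard_eq_top_iff.1 hBt
  obtain ⟨b, hb⟩ := hinf.nonempty
  have hbE := hB.subset_ground hb
  apply hM 1 {b} (M.E \ {b}) (by norm_num) (by norm_num)
  rw [vsep_iff _ _ (by rw [Set.union_sdiff_cancel]; simpa using hbE) Set.disjoint_sdiff_right]
  refine ⟨?_, ?_, ?_⟩
  · rw [ht]; simp
  · rw [(hB.indep.subset (Set.singleton_subset_iff.2 hb)).eRk_eq_encard]; simp
  · refine le_trans ?_ ((hB.indep.subset Set.sdiff_subset).encard_le_eRk_of_subset
      (Set.sdiff_subset_sdiff_left (t := {b}) hB.subset_ground))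
    rw [(Set.encard_eq_top_iff).2 (hinf.sdiff (Set.finite_singleton b))]
    exact le_top

variable {V : Type*} [AddCommGroup V] [Module (ZMod 2) V]

theorem basis_span {M : Matroid α} {φ : α → V}
    (hφ : ∀ I ⊆ M.E, (M.Indep I ↔ LinearIndependent (ZMod 2) fun x : I => φ x.1))
    {S I : Set α} (hI : M.IsBasis I S) :
    Submodule.span (ZMod 2) (φ '' I) = Submodule.span (ZMod 2) (φ '' S) := by
  apply le_antisymm (Submodule.span_mono (Set.image_mono hI.subset))
  rw [Submodule.span_le]
  rintro _ ⟨x, hx, rfl⟩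
  by_contra hc
  have h1 : LinearIndepOn (ZMod 2) φ I := (hφ I (hI.subset.trans hI.subset_ground)).1 hI.indep
  have h2 := h1.insert hc
  have h3 : insert x I ⊆ S := Set.insert_subset hx hI.subset
  have h4 := (hφ _ (h3.trans hI.subset_ground)).2 h2
  have h5 := hI.eq_of_subset_indep h4 (Set.subset_insert _ _) h3
  apply hc
  apply Submodule.subset_span
  exact ⟨x, by rw [h5]; exact Set.mem_insert _ _, rfl⟩

theorem eRk_eq_rank {M : Matroid α} {φ : α → V}
    (hφ : ∀ I ⊆ M.E, (M.Indep I ↔ LinearIndependent (ZMod 2) fun x : I => φ x.1))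
    {S : Set α} (hS : S ⊆ M.E) :
    M.eRk S = (Module.rank (ZMod 2) (Submodule.span (ZMod 2) (φ '' S))).toENat := by
  obtain ⟨I, hI⟩ := M.exists_isBasis S
  have h1 : LinearIndepOn (ZMod 2) φ I := (hφ I (hI.subset.trans hI.subset_ground)).1 hI.indep
  rw [← basis_span hφ hI, toENat_rank_span_set h1, hI.encard_eq_eRk]

theorem eRk_eq_rkf {M : Matroid α} {φ : α → V}
    (hφ : ∀ I ⊆ M.E, (M.Indep I ↔ LinearIndependent (ZMod 2) fun x : I => φ x.1))
    {S : Finset α} (hS : (S : Set α) ⊆ M.E) : M.eRk (S : Set α) = (rkf φ S : ℕ∞) := by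
  rw [eRk_eq_rank hφ hS]
  have := Module.finrank_eq_rank (ZMod 2) (spn φ S)
  unfold spn at this
  rw [← this, Cardinal.toENat_nat]
  rfl

theorem eRk_insert_span {M : Matroid α} {φ : α → V}
    (hφ : ∀ I ⊆ M.E, (M.Indep I ↔ LinearIndependent (ZMod 2) fun x : I => φ x.1))
    {S : Set α} (hS : S ⊆ M.E) {e : α} (he : e ∈ M.E)
    (h : φ e ∈ Submodule.span (ZMod 2) (φ '' S)) : M.eRk (insert e S) = M.eRk S := by
  rw [eRk_eq_rank hφ hS, eRk_eq_rank hφ (Set.insert_subset he hS), Set.image_insert_eq,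
    Submodule.span_insert_eq_span h]

theorem no_ext {M : Matroid α} (hM : VertConn M 4) {φ : α → V}
    (hφ : ∀ I ⊆ M.E, (M.Indep I ↔ LinearIndependent (ZMod 2) fun x : I => φ x.1))
    {e : α} (he : e ∈ M.E) {j : ℕ} (hj : 0 < j) (hj4 : j < 4) {X Y : Set α}
    (h : X ∪ Y = M.E \ {e}) (hd : Disjoint X Y)
    (hX : φ e ∈ Submodule.span (ZMod 2) (φ '' X)) : ¬ IsVSep (mdel M {e}) j X Y := by
  intro hs
  rw [vsep_del_iff M j e h hd] at hs
  have hXE : X ⊆ M.E \ {e} := by rw [← h]; exact Set.subset_union_left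
  have hYE : Y ⊆ M.E \ {e} := by rw [← h]; exact Set.subset_union_right
  have h1 := eRk_insert_span hφ (hXE.trans Set.sdiff_subset) he hX
  have h2 := eRk_insert_span hφ (S := M.E \ {e}) Set.sdiff_subset he
    (Submodule.span_mono (Set.image_mono hXE) hX)
  have h3 : insert e (M.E \ {e}) = M.E := by
    rw [Set.insert_sdiff_singleton, Set.insert_eq_of_mem he]
  rw [h3] at h2
  apply hM j (insert e X) Y hj hj4
  rw [vsep_iff M j (by rw [Set.insert_union, h, h3]) (by
    rw [Set.disjoint_insert_left]
    exact ⟨fun hh => (hYE hh).2 rfl, hd⟩), h1, h2]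
  exact hs

theorem no_dup {M : Matroid α} (hM : MinVertConn4 M) {φ : α → V}
    (hφ : ∀ I ⊆ M.E, (M.Indep I ↔ LinearIndependent (ZMod 2) fun x : I => φ x.1))
    {e : α} (he : e ∈ M.E) (hdup : φ e = 0 ∨ ∃ e' ∈ M.E, e' ≠ e ∧ φ e = φ e') : False := by
  apply hM.2 e he
  intro j X Y hj hj4 hs
  have h : X ∪ Y = M.E \ {e} := hs.1
  have hd := hs.2.1
  have hs' : IsVSep (mdel M {e}) j Y X := by
    rw [vsep_del_iff M j e h hd] at hs
    rw [vsep_del_iff M j e (by rw [Set.union_comm, h]) hd.symm, add_comm]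
    tauto
  have key : φ e ∈ Submodule.span (ZMod 2) (φ '' X) ∨ φ e ∈ Submodule.span (ZMod 2) (φ '' Y) := by
    rcases hdup with h0 | ⟨e', he', hne, h0⟩
    · left; rw [h0]; exact zero_mem _
    · have : e' ∈ X ∪ Y := by rw [h]; exact ⟨he', hne⟩
      rw [h0]
      exact this.imp (fun h => Submodule.subset_span ⟨e', h, rfl⟩)
        (fun h => Submodule.subset_span ⟨e', h, rfl⟩)
  rcases key with k | k
  · exact no_ext hM.1 hφ he hj hj4 h hd k hs
  · exact no_ext hM.1 hφ he hj hj4 (by rw [Set.union_comm, h]) hd.symm k hs'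

theorem fin_ground {M : Matroid α} (hM : VertConn M 4) {φ : α → V}
    (hφ : ∀ I ⊆ M.E, (M.Indep I ↔ LinearIndependent (ZMod 2) fun x : I => φ x.1))
    (inj : Set.InjOn φ M.E) : M.E.Finite := by
  obtain ⟨B, hB⟩ := M.exists_isBase
  have hfin : B.Finite := by
    rw [← Set.encard_ne_top_iff, hB.encard_eq_eRank, ← Matroid.eRk_ground]
    exact rank_ne_top hM
  have hsp := basis_span hφ hB.isBasis_ground
  have : FiniteDimensional (ZMod 2) (Submodule.span (ZMod 2) (φ '' M.E)) := by
    rw [← hsp]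
    exact FiniteDimensional.span_of_finite _ (hfin.image _)
  have h2 : Finite (Submodule.span (ZMod 2) (φ '' M.E)) := Module.finite_of_finite (ZMod 2)
  have h3 : (Submodule.span (ZMod 2) (φ '' M.E) : Set V).Finite := Set.finite_coe_iff.1 h2
  exact Set.Finite.of_finite_image (h3.subset Submodule.subset_span) inj

end transfer

/-- Every minimally vertically 4-connected binary matroid with at least six elements has a
4-element cocircuit. -/
theorem statement_1 (M : Matroid α) (hM : MinVertConn4 M) (hbin : IsBinary M)
    (hcard : 6 ≤ M.E.encard) :
    ∃ C, MCocircuit M C ∧ C.encard = 4 := by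
  classical
  obtain ⟨ι, φ, hφ⟩ := hbin
  have inj : Set.InjOn φ M.E := by
    intro x hx y hy hxy
    by_contra hne
    exact no_dup hM hφ hx (Or.inr ⟨y, hy, fun h => hne h.symm, hxy⟩)
  have nz : ∀ x ∈ M.E, φ x ≠ 0 := fun x hx h => no_dup hM hφ hx (Or.inl h)
  have hfin := fin_ground hM.1 hφ inj
  obtain ⟨E, hE⟩ : ∃ E : Finset α, (E : Set α) = M.E := ⟨hfin.toFinset, by simp⟩
  have mE : ∀ x, x ∈ E ↔ x ∈ M.E := fun x => by rw [← hE]; simp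
  have rk : ∀ S : Finset α, S ⊆ E → M.eRk (S : Set α) = (rkf φ S : ℕ∞) := fun S hS =>
    eRk_eq_rkf hφ (by rw [← hE]; exact_mod_cast hS)
  have conn : FConn φ E := by
    intro j j1 j3 S T cov dj rS rT
    by_contra hc
    have hS : S ⊆ E := fun a ha => (cov a).2 (Or.inl ha)
    have hT : T ⊆ E := fun a ha => (cov a).2 (Or.inr ha)
    apply hM.1 j S T (by omega) (by omega)
    rw [vsep_iff M j (by ext a; rw [← mE, cov]; simp) (by
      rw [Set.disjoint_left]; intro a ha hb; exact dj a (by simpa using ha) (by simpa using hb)),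
      ← hE, rk S hS, rk T hT, rk E subset_rfl]
    refine ⟨?_, by exact_mod_cast rS, by exact_mod_cast rT⟩
    have : rkf φ S + rkf φ T - rkf φ E < j := by omega
    exact_mod_cast this
  have hmin : FMinim φ E := by
    intro e he
    have h := hM.2 e ((mE e).1 he)
    unfold VertConn at h
    push Not at h
    obtain ⟨j, X, Y, j1, j3, hs⟩ := h
    have hu : X ∪ Y = M.E \ {e} := hs.1
    have hd := hs.2.1
    rw [vsep_del_iff M j e hu hd] at hs
    have hXE : X ⊆ M.E \ {e} := by rw [← hu]; exact Set.subset_union_left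
    have hYE : Y ⊆ M.E \ {e} := by rw [← hu]; exact Set.subset_union_right
    obtain ⟨X, rfl⟩ : ∃ S : Finset α, (S : Set α) = X :=
      ⟨(hfin.subset (hXE.trans Set.sdiff_subset)).toFinset, by simp⟩
    obtain ⟨Y, rfl⟩ : ∃ S : Finset α, (S : Set α) = Y :=
      ⟨(hfin.subset (hYE.trans Set.sdiff_subset)).toFinset, by simp⟩
    have hee : M.E \ {e} = ((E.erase e : Finset α) : Set α) := by
      ext a; rw [Set.mem_sdiff, ← mE]; simp [and_comm]
    have hX : X ⊆ E := fun a ha => (mE a).2 (hXE (by simpa using ha)).1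
    have hY : Y ⊆ E := fun a ha => (mE a).2 (hYE (by simpa using ha)).1
    rw [hee, rk X hX, rk Y hY, rk _ (Finset.erase_subset _ _)] at hs
    obtain ⟨s1, s2, s3⟩ := hs
    have s1' : rkf φ X + rkf φ Y - rkf φ (E.erase e) < j := by exact_mod_cast s1
    have s2' : j ≤ rkf φ X := by exact_mod_cast s2
    have s3' : j ≤ rkf φ Y := by exact_mod_cast s3
    refine ⟨j, X, Y, j1, by omega, fun h => (hXE (by simpa using h)).2 rfl,
      fun h => (hYE (by simpa using h)).2 rfl, ?_, ?_, s2', s3', by omega⟩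
    · intro a ha hb
      exact Set.disjoint_left.1 hd (by simpa using ha) (by simpa using hb)
    · intro a
      have h1 := Set.ext_iff.1 hu a
      rw [Set.mem_sdiff, ← mE, Set.mem_union, Finset.mem_coe, Finset.mem_coe,
        Set.mem_singleton_iff] at h1
      by_cases hae : a = e
      · subst hae; simp [he]
      · tauto
  have hc : 6 ≤ E.card := by
    rw [← hE, Set.encard_coe_eq_coe_finsetCard] at hcard
    exact_mod_cast hcard
  obtain ⟨T, hT, cT, h1, h2⟩ := core_main (E := E) (fun x hx y hy h =>
    inj ((mE x).1 hx) ((mE y).1 hy) h) (fun x hx => nz x ((mE x).1 hx)) conn hmin hc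
  have hTE : (T : Set α) ⊆ M.E := by rw [← hE]; exact_mod_cast hT
  have hrf : M.RankFinite := by
    rw [← Matroid.eRank_ne_top_iff, ← Matroid.eRk_ground]; exact rank_ne_top hM.1
  have hco : ∀ D : Finset α, D ⊆ E → (M✶.Indep (D : Set α) ↔ rkf φ E ≤ rkf φ (E \ D)) := by
    intro D hD
    have hDE : (D : Set α) ⊆ M.E := by rw [← hE]; exact_mod_cast hD
    have h3 : M.E \ (D : Set α) = ((E \ D : Finset α) : Set α) := by rw [← hE]; simp
    rw [← Matroid.coindep_def, Matroid.coindep_iff_compl_spanning hDE,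
      Matroid.spanning_iff_eRk_le Set.sdiff_subset, ← Matroid.eRk_ground, h3,
      rk _ Finset.sdiff_subset, ← hE, rk E subset_rfl, Nat.cast_le]
  refine ⟨(T : Set α), ⟨?_, ?_⟩, ?_⟩
  · rw [Matroid.dep_iff]
    refine ⟨?_, hTE⟩
    rw [hco T hT]; omega
  · intro D hD
    obtain ⟨t, ht, htD⟩ := Set.exists_of_ssubset hD
    have ht' : t ∈ T := by simpa using ht
    have hsub : D ⊆ ((T.erase t : Finset α) : Set α) := by
      intro a ha
      have := hD.subset ha
      rw [Finset.coe_erase]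
      exact ⟨this, fun h => htD (h ▸ ha)⟩
    refine Matroid.Indep.subset ?_ hsub
    rw [hco _ ((Finset.erase_subset _ _).trans hT), h2 t ht']
  · rw [Set.encard_coe_eq_coe_finsetCard, cT]; rfl
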